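/- arXiv:1702.00057 — 2 statements merged into one kernel-verified Lean document; each statement's English description precedes it below -/
import Mathlib

section
/- Let Assumption A hold and suppose the switched system ẋ = f(t,x,u,σ) is 0-GUAS w.r.t. S, with β ∈ KL such that every zero-input solution satisfies |x(t)| ≤ β(|x(t₀)|, t−t₀). Let χ be a class-K∞ function with χ(r) ≥ γ(r) for all r ≥ 0, where γ is as in (C1) of Assumption A. Then for every r > 0 and every η > 0 there exist L = L(r) > 0 and κ = κ(r,η) > 0 such that: if x ∈ T(t₀,u,σ) with t₀ ≥ 0, u ∈ U_m, σ ∈ S, and |x(t)| ≤ r for all t ≥ t₀, then |x(t)| ≤ β(|x(t₀)|, t−t₀) + [η (t−t₀) + κ ∫_{t₀}^t χ(|u(τ)|) dτ] e^{L(t−t₀)} for all t ≥ t₀. -/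
open MeasureTheory Set Filter Topology

noncomputable section

/-- A class-`K` function: continuous and strictly increasing on `[0,∞)` with `φ 0 = 0`. -/
def ClassK (φ : ℝ → ℝ) : Prop :=
  ContinuousOn φ (Set.Ici 0) ∧ StrictMonoOn φ (Set.Ici 0) ∧ φ 0 = 0

/-- A class-`K∞` function: class `K` and unbounded. -/
def ClassKInf (φ : ℝ → ℝ) : Prop :=
  ClassK φ ∧ Filter.Tendsto φ Filter.atTop Filter.atTop

/-- A class-`KL` function: `β (·, t)` is of class `K∞` for each `t ≥ 0` and `β (r, ·)`
decreases monotonically to `0` for each fixed `r ≥ 0`. -/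
def ClassKL (β : ℝ → ℝ → ℝ) : Prop :=
  (∀ t, 0 ≤ t → ClassKInf fun r => β r t) ∧
  (∀ r, 0 ≤ r → AntitoneOn (fun t => β r t) (Set.Ici 0) ∧
    Filter.Tendsto (fun t => β r t) Filter.atTop (nhds 0))

/-- A continuous positive definite function on `[0,∞)`. -/
def PosDefFun (φ : ℝ → ℝ) : Prop :=
  ContinuousOn φ (Set.Ici 0) ∧ φ 0 = 0 ∧ ∀ s, 0 < s → 0 < φ s

variable {Γ : Type*} {E : Type*} {F : Type*} {P : Type*}
  [NormedAddCommGroup E] [NormedSpace ℝ E]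
  [NormedAddCommGroup F] [NormedSpace ℝ F]
  [NormedAddCommGroup P]
  [MeasurableSpace E] [MeasurableSpace F] [MeasurableSpace P]

/-- A switching signal: piecewise constant with finitely many discontinuities on every
bounded interval of `[0,∞)`, and right-continuous. -/
def IsSwitchingSignal (σ : ℝ → Γ) : Prop :=
  ∀ b : ℝ, 0 < b → ∃ (n : ℕ) (t : ℕ → ℝ), t 0 = 0 ∧ (∀ i < n, t i < t (i + 1)) ∧ b ≤ t n ∧
    ∀ i < n, ∀ s ∈ Set.Ico (t i) (t (i + 1)), σ s = σ (t i)

/-- An admissible input: Lebesgue measurable and locally essentially bounded. -/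
def IsInput (u : ℝ → F) : Prop :=
  Measurable u ∧ ∀ b : ℝ, ∃ C : ℝ, ∀ᵐ s ∂volume, s ∈ Set.Icc (0 : ℝ) b → ‖u s‖ ≤ C

/-- A Carathéodory solution of `ẋ = f t x u σ` on the domain `D ⊆ [0,∞)` (an interval):
a continuous function satisfying the corresponding integral equation. -/
structure IsSolution (f : ℝ → E → F → Γ → E) (u : ℝ → F) (σ : ℝ → Γ)
    (D : Set ℝ) (x : ℝ → E) : Prop where
  ordConnected : D.OrdConnected
  subset_Ici : D ⊆ Set.Ici 0
  nonempty : D.Nonempty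
  continuousOn : ContinuousOn x D
  intervalIntegrable : ∀ a ∈ D, ∀ b ∈ D,
    IntervalIntegrable (fun s => f s (x s) (u s) (σ s)) volume a b
  integral_eq : ∀ a ∈ D, ∀ b ∈ D, x b = x a + ∫ s in a..b, f s (x s) (u s) (σ s)

/-- A maximally defined Carathéodory solution: one admitting no proper extension. -/
def IsMaximalSolution (f : ℝ → E → F → Γ → E) (u : ℝ → F) (σ : ℝ → Γ)
    (D : Set ℝ) (x : ℝ → E) : Prop :=
  IsSolution f u σ D x ∧
    ∀ D' : Set ℝ, ∀ x' : ℝ → E, IsSolution f u σ D' x' → D ⊆ D' → Set.EqOn x x' D → D' ⊆ D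

/-- Standing regularity assumptions on `f`: vanishing at the origin for zero input,
Lebesgue measurable in `t`, continuous in `(ξ, μ)`. -/
def Regular (f : ℝ → E → F → Γ → E) : Prop :=
  (∀ t, 0 ≤ t → ∀ i, f t 0 0 i = 0) ∧
  (∀ ξ μ i, Measurable fun t => f t ξ μ i) ∧
  (∀ t i, Continuous fun q : E × F => f t q.1 q.2 i)

/-- Forward completeness w.r.t. `S`. -/
def ForwardComplete (f : ℝ → E → F → Γ → E) (S : Set (ℝ → Γ)) : Prop :=
  ∀ t₀, 0 ≤ t₀ → ∀ u : ℝ → F, IsInput u → ∀ σ ∈ S, ∀ D x,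
    IsMaximalSolution f u σ D x → t₀ ∈ D → Set.Ici t₀ ⊆ D

/-- iISS w.r.t. `S` with iISS gain `χ`. -/
def IISS (f : ℝ → E → F → Γ → E) (S : Set (ℝ → Γ)) (χ : ℝ → ℝ) : Prop :=
  ForwardComplete f S ∧
  ∃ β ρ, ClassKL β ∧ ClassK ρ ∧
    ∀ t₀, 0 ≤ t₀ → ∀ u : ℝ → F, IsInput u → ∀ σ ∈ S, ∀ D x,
      IsMaximalSolution f u σ D x → t₀ ∈ D → ∀ t ∈ D, t₀ ≤ t →
        ‖x t‖ ≤ β ‖x t₀‖ (t - t₀) + ρ (∫ s in t₀..t, χ ‖u s‖)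

/-- 0-GUAS w.r.t. `S`. -/
def ZeroGUAS (f : ℝ → E → F → Γ → E) (S : Set (ℝ → Γ)) : Prop :=
  ∃ β, ClassKL β ∧
    ∀ t₀, 0 ≤ t₀ → ∀ σ ∈ S, ∀ D x,
      IsMaximalSolution f (fun _ => (0 : F)) σ D x → t₀ ∈ D → ∀ t ∈ D, t₀ ≤ t →
        ‖x t‖ ≤ β ‖x t₀‖ (t - t₀)

/-- UBEBS w.r.t. `S` with UBEBS gain `α`. -/
def UBEBS (f : ℝ → E → F → Γ → E) (S : Set (ℝ → Γ)) (α : ℝ → ℝ) : Prop :=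
  ∃ α₁ α₂ c, ClassK α₁ ∧ ClassK α₂ ∧ 0 ≤ c ∧
    ∀ t₀, 0 ≤ t₀ → ∀ u : ℝ → F, IsInput u → ∀ σ ∈ S, ∀ D x,
      IsMaximalSolution f u σ D x → t₀ ∈ D → ∀ t ∈ D, t₀ ≤ t →
        ‖x t‖ ≤ α₁ ‖x t₀‖ + α₂ (∫ s in t₀..t, α ‖u s‖) + c

/-- The total `χ`-energy `∫_0^∞ χ(|u(s)|) ds` of an input, as an extended nonnegative real. -/
def Energy (χ : ℝ → ℝ) (u : ℝ → F) : ENNReal :=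
  ∫⁻ s in Set.Ioi (0 : ℝ), ENNReal.ofReal (χ ‖u s‖)

/-- `χ`-BEICS w.r.t. `S`: every solution corresponding to an input of finite `χ`-energy
is defined for all future times and converges to `0`. -/
def BEICS (f : ℝ → E → F → Γ → E) (S : Set (ℝ → Γ)) (χ : ℝ → ℝ) : Prop :=
  ∀ t₀, 0 ≤ t₀ → ∀ u : ℝ → F, IsInput u → ∀ σ ∈ S, ∀ D x,
    IsMaximalSolution f u σ D x → t₀ ∈ D → Energy χ u ≠ ⊤ →
      Set.Ici t₀ ⊆ D ∧ Filter.Tendsto x Filter.atTop (nhds 0)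

/-- Condition (C1) of Assumption A, with the class-`K` function `γ`. -/
def CondC1 (f : ℝ → E → F → Γ → E) (γ : ℝ → ℝ) : Prop :=
  ∃ N : ℝ → ℝ, (∀ r, 0 ≤ r → 0 < N r) ∧ MonotoneOn N (Set.Ici 0) ∧
    ∀ t, 0 ≤ t → ∀ (ξ : E) (μ : F) (i : Γ), ‖f t ξ μ i‖ ≤ N ‖ξ‖ * (1 + γ ‖μ‖)

/-- Condition (C2) of Assumption A. -/
def CondC2 (f : ℝ → E → F → Γ → E) : Prop :=
  ∀ r, 0 < r → ∀ ε, 0 < ε → ∃ δ, 0 < δ ∧ ∀ t, 0 ≤ t → ∀ (i : Γ) (ξ : E) (μ : F),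
    ‖ξ‖ ≤ r → ‖μ‖ ≤ δ → ‖f t ξ μ i - f t ξ 0 i‖ < ε

/-- Condition (C3) of Assumption A: `f (t, ξ, 0, i)` is locally Lipschitz in `ξ`
uniformly in `t` and `i`. -/
def CondC3 (f : ℝ → E → F → Γ → E) : Prop :=
  ∀ K : Set E, IsCompact K → ∃ L, 0 ≤ L ∧ ∀ t, 0 ≤ t → ∀ (i : Γ), ∀ ξ ∈ K, ∀ ξ' ∈ K,
    ‖f t ξ 0 i - f t ξ' 0 i‖ ≤ L * ‖ξ - ξ'‖

/-- Assumption A, with `γ` the class-`K` function appearing in (C1). -/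
def AssumptionA (f : ℝ → E → F → Γ → E) (γ : ℝ → ℝ) : Prop :=
  ClassK γ ∧ CondC1 f γ ∧ CondC2 f ∧ CondC3 f

/-- Sandwich bounds `φ₁(|ξ|) ≤ V(t,ξ) ≤ φ₂(|ξ|)` with `φ₁, φ₂` of class `K∞`. -/
def StorageBounds (V : ℝ → E → ℝ) : Prop :=
  ∃ φ₁ φ₂, ClassKInf φ₁ ∧ ClassKInf φ₂ ∧
    ∀ t, 0 ≤ t → ∀ ξ : E, φ₁ ‖ξ‖ ≤ V t ξ ∧ V t ξ ≤ φ₂ ‖ξ‖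

/-- 0-OD (zero-output dissipativity) w.r.t. `S` witnessed by the storage function `V`
and the supply function `α`. -/
def ZeroODWithStorage (f : ℝ → E → F → Γ → E) (S : Set (ℝ → Γ)) (V : ℝ → E → ℝ)
    (α : ℝ → ℝ) : Prop :=
  StorageBounds V ∧
    ∀ t₀, 0 ≤ t₀ → ∀ u : ℝ → F, IsInput u → ∀ σ ∈ S, ∀ D x,
      IsMaximalSolution f u σ D x → t₀ ∈ D → ∀ t ∈ D, t₀ ≤ t →
        V t (x t) ≤ V t₀ (x t₀) + ∫ s in t₀..t, α ‖u s‖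

/-- 0-OD w.r.t. `S` with supply function `α`. -/
def ZeroOD (f : ℝ → E → F → Γ → E) (S : Set (ℝ → Γ)) (α : ℝ → ℝ) : Prop :=
  ∃ V : ℝ → E → ℝ, (∀ t ξ, 0 ≤ V t ξ) ∧ ZeroODWithStorage f S V α

/-- `h`-OD (output dissipativity) w.r.t. `S` with supply function `α`. -/
def HOD (f : ℝ → E → F → Γ → E) (h : ℝ → E → F → Γ → P) (S : Set (ℝ → Γ))
    (α : ℝ → ℝ) : Prop :=
  ∃ V : ℝ → E → ℝ, (∀ t ξ, 0 ≤ V t ξ) ∧ StorageBounds V ∧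
    ∃ α₃, PosDefFun α₃ ∧
      ∀ t₀, 0 ≤ t₀ → ∀ u : ℝ → F, IsInput u → ∀ σ ∈ S, ∀ D x,
        IsMaximalSolution f u σ D x → t₀ ∈ D → ∀ t ∈ D, t₀ ≤ t →
          V t (x t) ≤ V t₀ (x t₀) - (∫ s in t₀..t, α₃ ‖h s (x s) (u s) (σ s)‖)
            + ∫ s in t₀..t, α ‖u s‖

/-- The pair `(h, f)` is zero-input output-persistently exciting w.r.t. `S`. -/
def OutputPE (f : ℝ → E → F → Γ → E) (h : ℝ → E → F → Γ → P)
    (S : Set (ℝ → Γ)) : Prop :=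
  ∀ ε : ℝ, 0 < ε → ε ≤ 1 → ∃ T, 0 < T ∧ ∃ r, 0 < r ∧
    ∀ t₀, 0 ≤ t₀ → ∀ σ ∈ S, ∀ D x,
      IsMaximalSolution f (fun _ => (0 : F)) σ D x → t₀ ∈ D →
        ∀ t, t₀ ≤ t → Set.Icc t (t + T) ⊆ D →
          (∀ τ ∈ Set.Icc t (t + T), ε ≤ ‖x τ‖ ∧ ‖x τ‖ ≤ 1 / ε) →
            r ≤ ∫ τ in t..(t + T), ‖h τ (x τ) 0 (σ τ)‖ ^ 2

/-- Standing regularity assumptions on the output map `h`. -/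
def OutputRegular (h : ℝ → E → F → Γ → P) : Prop :=
  (∀ ξ μ i, Measurable fun t => h t ξ μ i) ∧
  (∀ t i, Continuous fun q : E × F => h t q.1 q.2 i) ∧
  ∀ K : Set E, IsCompact K → (0 : E) ∉ K → ∃ M : ℝ,
    ∀ᵐ t ∂volume, 0 ≤ t → ∀ ξ ∈ K, ∀ i : Γ, ‖h t ξ 0 i‖ ≤ M

section Auxiliary

variable {X Y ι : Type*} [NormedAddCommGroup X] [NormedSpace ℝ X]

/-- If any two points of `D` lie in the domain of a solution that agrees with `x`, then `x` is a
solution on `D`. -/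
theorem isSolution_of_forall_pair {f : ℝ → X → Y → ι → X} {u : ℝ → Y} {σ : ℝ → ι}
    {D : Set ℝ} {x : ℝ → X} (hne : D.Nonempty)
    (h : ∀ a ∈ D, ∀ b ∈ D, ∃ D' x', IsSolution f u σ D' x' ∧ a ∈ D' ∧ b ∈ D' ∧ D' ⊆ D ∧
      EqOn x' x D') : IsSolution f u σ D x := by
  have hord : D.OrdConnected := ⟨fun a ha b hb => by
    obtain ⟨D', x', hs, ha', hb', hD, -⟩ := h a ha b hb
    exact (hs.ordConnected.out ha' hb').trans hD⟩
  refine ⟨hord, ?_, hne, ?_, ?_, ?_⟩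
  · intro a ha
    obtain ⟨D', x', hs, ha', -⟩ := h a ha a ha
    exact hs.subset_Ici ha'
  · intro t ht
    obtain ⟨a, ha, hat⟩ : ∃ a ∈ D, Ici a ∈ 𝓝[D] t := by
      by_cases hlt : ∃ a ∈ D, a < t
      · obtain ⟨a, ha, hat⟩ := hlt
        exact ⟨a, ha, mem_nhdsWithin_of_mem_nhds (Ici_mem_nhds hat)⟩
      · push Not at hlt
        exact ⟨t, ht, mem_of_superset self_mem_nhdsWithin fun s hs => hlt s hs⟩
    obtain ⟨b, hb, hbt⟩ : ∃ b ∈ D, Iic b ∈ 𝓝[D] t := by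
      by_cases hlt : ∃ b ∈ D, t < b
      · obtain ⟨b, hb, hbt⟩ := hlt
        exact ⟨b, hb, mem_nhdsWithin_of_mem_nhds (Iic_mem_nhds hbt)⟩
      · push Not at hlt
        exact ⟨t, ht, mem_of_superset self_mem_nhdsWithin fun s hs => hlt s hs⟩
    obtain ⟨D', x', hs, ha', hb', hD, heq⟩ := h a ha b hb
    have hmem : D' ∈ 𝓝[D] t :=
      mem_of_superset (inter_mem hat hbt) (hs.ordConnected.out ha' hb')
    have hcont : ContinuousOn x D' := hs.continuousOn.congr heq.symm
    exact (hcont t (mem_of_mem_nhdsWithin ht hmem)).mono_of_mem_nhdsWithin hmem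
  · intro a ha b hb
    obtain ⟨D', x', hs, ha', hb', hD, heq⟩ := h a ha b hb
    refine (hs.intervalIntegrable a ha' b hb').congr ?_
    intro s hm
    simp only [heq (hs.ordConnected.uIcc_subset ha' hb' (uIoc_subset_uIcc hm))]
  · intro a ha b hb
    obtain ⟨D', x', hs, ha', hb', hD, heq⟩ := h a ha b hb
    rw [← heq ha', ← heq hb', hs.integral_eq a ha' b hb']
    congr 1
    refine intervalIntegral.integral_congr fun s hm => ?_
    simp only [heq (hs.ordConnected.uIcc_subset ha' hb' hm)]

theorem IsSolution.mono {f : ℝ → X → Y → ι → X} {u : ℝ → Y} {σ : ℝ → ι}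
    {D D' : Set ℝ} {x : ℝ → X} (h : IsSolution f u σ D x) (hord : D'.OrdConnected)
    (hne : D'.Nonempty) (hD : D' ⊆ D) : IsSolution f u σ D' x :=
  ⟨hord, hD.trans h.subset_Ici, hne, h.continuousOn.mono hD,
    fun a ha b hb => h.intervalIntegrable a (hD ha) b (hD hb),
    fun a ha b hb => h.integral_eq a (hD ha) b (hD hb)⟩

/-- Every solution extends to a maximal one. -/
theorem IsSolution.exists_maximal_extension {f : ℝ → X → Y → ι → X} {u : ℝ → Y} {σ : ℝ → ι}
    {D : Set ℝ} {x : ℝ → X} (h : IsSolution f u σ D x) :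
    ∃ D' x', IsMaximalSolution f u σ D' x' ∧ D ⊆ D' ∧ EqOn x x' D := by
  classical
  let α := {p : Set ℝ × (ℝ → X) // IsSolution f u σ p.1 p.2 ∧ D ⊆ p.1 ∧ EqOn x p.2 D}
  let R : α → α → Prop := fun p q => p.1.1 ⊆ q.1.1 ∧ EqOn p.1.2 q.1.2 p.1.1
  have : Nonempty α := ⟨⟨(D, x), h, Subset.rfl, fun _ _ => rfl⟩⟩
  have htrans : ∀ {p q s : α}, R p q → R q s → R p s := fun {p q s} hpq hqs =>
    ⟨hpq.1.trans hqs.1, fun t ht => (hpq.2 ht).trans (hqs.2 (hpq.1 ht))⟩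
  obtain ⟨m, hm⟩ : ∃ m : α, ∀ p, R m p → R p m := by
    refine exists_maximal_of_nonempty_chains_bounded (fun c hc hcne => ?_) htrans
    have hpair : ∀ p ∈ c, ∀ q ∈ c, R p q ∨ R q p := fun p hp q hq => by
      by_cases hpq : p = q
      · exact Or.inl (hpq ▸ ⟨Subset.rfl, fun _ _ => rfl⟩)
      · exact hc hp hq hpq
    let y : ℝ → X := fun t => if ht : ∃ p ∈ c, t ∈ p.1.1 then ht.choose.1.2 t else 0
    have hy : ∀ p ∈ c, EqOn p.1.2 y p.1.1 := by
      intro p hp t ht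
      have hex : ∃ p ∈ c, t ∈ p.1.1 := ⟨p, hp, ht⟩
      have hyt : y t = hex.choose.1.2 t := dif_pos hex
      rw [hyt]
      rcases hpair p hp _ hex.choose_spec.1 with hR | hR
      · exact hR.2 ht
      · exact (hR.2 hex.choose_spec.2).symm
    have hsub : ∀ p ∈ c, p.1.1 ⊆ ⋃ q ∈ c, q.1.1 := fun p hp => subset_biUnion_of_mem
      (u := fun q : α => q.1.1) hp
    obtain ⟨p₀, hp₀⟩ := hcne
    have hsol : IsSolution f u σ (⋃ q ∈ c, q.1.1) y := by
      refine isSolution_of_forall_pair (p₀.2.1.nonempty.mono (hsub p₀ hp₀)) ?_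
      intro a ha b hb
      simp only [mem_iUnion, exists_prop] at ha hb
      obtain ⟨p, hp, hap⟩ := ha
      obtain ⟨q, hq, hbq⟩ := hb
      rcases hpair p hp q hq with hR | hR
      · exact ⟨_, _, q.2.1, hR.1 hap, hbq, hsub q hq, hy q hq⟩
      · exact ⟨_, _, p.2.1, hap, hR.1 hbq, hsub p hp, hy p hp⟩
    exact ⟨⟨(_, y), hsol, p₀.2.2.1.trans (hsub p₀ hp₀),
      fun t ht => (p₀.2.2.2 ht).trans (hy p₀ hp₀ (p₀.2.2.1 ht))⟩,
      fun p hp => ⟨hsub p hp, hy p hp⟩⟩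
  refine ⟨m.1.1, m.1.2, ⟨m.2.1, fun D' x' hs hD heq => ?_⟩, m.2.2⟩
  exact (hm ⟨(D', x'), hs, m.2.2.1.trans hD,
    fun t ht => (m.2.2.2 ht).trans (heq (m.2.2.1 ht))⟩ ⟨hD, heq⟩).1

/-- The radial retraction of a normed space onto the closed ball of radius `R`. -/
def radialRetraction (R : ℝ) (ξ : X) : X := (R / max R ‖ξ‖) • ξ

theorem radialRetraction_of_norm_le {R : ℝ} (hR : 0 < R) {ξ : X} (h : ‖ξ‖ ≤ R) :
    radialRetraction R ξ = ξ := by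
  rw [radialRetraction, max_eq_left h, div_self hR.ne', one_smul]

theorem norm_radialRetraction_le {R : ℝ} (hR : 0 < R) (ξ : X) :
    ‖radialRetraction R ξ‖ ≤ R := by
  have hpos : 0 < max R ‖ξ‖ := lt_max_of_lt_left hR
  rw [radialRetraction, norm_smul, Real.norm_of_nonneg (by positivity), div_mul_eq_mul_div,
    div_le_iff₀ hpos]
  exact mul_le_mul_of_nonneg_left (le_max_right _ _) hR.le

theorem norm_radialRetraction_sub_le {R : ℝ} (hR : 0 < R) (ξ ζ : X) :
    ‖radialRetraction R ξ - radialRetraction R ζ‖ ≤ 2 * ‖ξ - ζ‖ := by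
  have ha : 0 < max R ‖ξ‖ := lt_max_of_lt_left hR
  have hb : 0 < max R ‖ζ‖ := lt_max_of_lt_left hR
  have hdecomp : radialRetraction R ξ - radialRetraction R ζ =
      (R / max R ‖ξ‖) • (ξ - ζ) +
        ((R / max R ‖ξ‖) * ((max R ‖ζ‖ - max R ‖ξ‖) / max R ‖ζ‖)) • ζ := by
    have hcoef : (R / max R ‖ξ‖) * ((max R ‖ζ‖ - max R ‖ξ‖) / max R ‖ζ‖) =
        R / max R ‖ξ‖ - R / max R ‖ζ‖ := by
      field_simp
    rw [hcoef, radialRetraction, radialRetraction]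
    module
  have hle : R / max R ‖ξ‖ ≤ 1 := (div_le_one ha).2 (le_max_left _ _)
  have hnn : 0 ≤ R / max R ‖ξ‖ := by positivity
  have hdiff : |max R ‖ζ‖ - max R ‖ξ‖| ≤ ‖ξ - ζ‖ := by
    have hmax := abs_max_sub_max_le_abs ‖ζ‖ ‖ξ‖ R
    rw [max_comm ‖ζ‖, max_comm ‖ξ‖] at hmax
    exact hmax.trans (by rw [norm_sub_rev]; exact abs_norm_sub_norm_le ζ ξ)
  have hquot : ‖ζ‖ / max R ‖ζ‖ ≤ 1 := (div_le_one hb).2 (le_max_right _ _)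
  rw [hdecomp]
  refine (norm_add_le _ _).trans ?_
  rw [norm_smul, norm_smul, Real.norm_of_nonneg hnn, norm_mul, Real.norm_of_nonneg hnn, norm_div,
    Real.norm_of_nonneg hb.le, Real.norm_eq_abs]
  have hsecond : R / max R ‖ξ‖ * (|max R ‖ζ‖ - max R ‖ξ‖| / max R ‖ζ‖) * ‖ζ‖ ≤ ‖ξ - ζ‖ := by
    calc R / max R ‖ξ‖ * (|max R ‖ζ‖ - max R ‖ξ‖| / max R ‖ζ‖) * ‖ζ‖
        = R / max R ‖ξ‖ * |max R ‖ζ‖ - max R ‖ξ‖| * (‖ζ‖ / max R ‖ζ‖) := by ring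
      _ ≤ 1 * ‖ξ - ζ‖ * 1 := by gcongr
      _ = ‖ξ - ζ‖ := by ring
  have hfirst : R / max R ‖ξ‖ * ‖ξ - ζ‖ ≤ ‖ξ - ζ‖ := mul_le_of_le_one_left (norm_nonneg _) hle
  linarith

theorem continuous_radialRetraction {R : ℝ} (hR : 0 < R) :
    Continuous (radialRetraction R : X → X) := by
  unfold radialRetraction
  refine Continuous.smul (continuous_const.div (by fun_prop) fun ξ => ?_) continuous_id
  exact (lt_max_of_lt_left hR).ne'

/-- Banach's fixed point theorem for the Volterra integral equation, in a norm with exponential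
weight: a vector field that is Lipschitz in the state and merely integrable in time along
continuous curves has a solution on the whole interval. -/
theorem exists_integral_eq_of_lipschitz [CompleteSpace X] {g : ℝ → X → X} {a b K : ℝ}
    (hab : a ≤ b) (hK : 0 < K)
    (hInt : ∀ w : ℝ → X, Continuous w → IntervalIntegrable (fun s => g s (w s)) volume a b)
    (hlip : ∀ s ∈ Icc a b, ∀ ξ ζ, ‖g s ξ - g s ζ‖ ≤ K * ‖ξ - ζ‖) (ξ₀ : X) :
    ∃ z : ℝ → X, Continuous z ∧ ∀ t ∈ Icc a b, z t = ξ₀ + ∫ s in a..t, g s (z s) := by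
  let w : C(Icc a b, X) → ℝ → X := fun v s => Real.exp (2 * K * (s - a)) • v (projIcc a b hab s)
  have hw : ∀ v, Continuous (w v) := fun v => by
    have := continuous_projIcc (h := hab)
    fun_prop
  have hInt' : ∀ v, ∀ t ∈ Icc a b, IntervalIntegrable (fun s => g s (w v s)) volume a t :=
    fun v t ht => (hInt _ (hw v)).mono_set
      (uIcc_subset_uIcc left_mem_uIcc (Icc_subset_uIcc ht))
  have hprim : ∀ v, ContinuousOn (fun t => ∫ s in a..t, g s (w v s)) (Icc a b) := fun v => by
    have := intervalIntegral.continuousOn_primitive_interval' (hInt _ (hw v)) left_mem_uIcc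
    rwa [uIcc_of_le hab] at this
  let Φ : C(Icc a b, X) → C(Icc a b, X) := fun v =>
    ⟨fun t => Real.exp (-(2 * K * (t - a))) • (ξ₀ + ∫ s in a..(t : ℝ), g s (w v s)), by
      have : Continuous fun t : Icc a b => ∫ s in a..(t : ℝ), g s (w v s) :=
        (hprim v).domRestrict
      fun_prop⟩
  have hΦ : ContractingWith (1 / 2) Φ := by
    refine ⟨by rw [← NNReal.coe_lt_coe]; norm_num, LipschitzWith.of_dist_le_mul fun v₁ v₂ => ?_⟩
    rw [ContinuousMap.dist_le (by positivity)]
    intro t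
    have hbound : ‖∫ s in a..(t : ℝ), (g s (w v₁ s) - g s (w v₂ s))‖ ≤
        ∫ s in a..(t : ℝ), K * (Real.exp (2 * K * (s - a)) * dist v₁ v₂) := by
      refine intervalIntegral.norm_integral_le_of_norm_le t.2.1 (Eventually.of_forall ?_)
        (Continuous.intervalIntegrable (by fun_prop) _ _)
      intro s hs
      refine (hlip s ⟨hs.1.le, hs.2.trans t.2.2⟩ _ _).trans ?_
      gcongr
      rw [← smul_sub, norm_smul, Real.norm_of_nonneg (Real.exp_pos _).le, ← dist_eq_norm]
      gcongr
      exact ContinuousMap.dist_apply_le_dist _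
    have hval : ∫ s in a..(t : ℝ), K * (Real.exp (2 * K * (s - a)) * dist v₁ v₂) =
        Real.exp (2 * K * (t - a)) * dist v₁ v₂ / 2 - dist v₁ v₂ / 2 := by
      rw [intervalIntegral.integral_eq_sub_of_hasDerivAt
        (f := fun s => Real.exp (2 * K * (s - a)) * dist v₁ v₂ / 2)]
      · simp
      · intro s _
        have hlin : HasDerivAt (fun s : ℝ => 2 * K * (s - a)) (2 * K) s := by
          simpa using ((hasDerivAt_id s).sub_const a).const_mul (2 * K)
        convert! (hlin.exp.mul_const (dist v₁ v₂)).div_const 2 using 1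
        ring
      · exact Continuous.intervalIntegrable (by fun_prop) _ _
    have hdiff : Φ v₁ t - Φ v₂ t = Real.exp (-(2 * K * (t - a))) •
        ∫ s in a..(t : ℝ), (g s (w v₁ s) - g s (w v₂ s)) := by
      rw [intervalIntegral.integral_sub (hInt' v₁ t t.2) (hInt' v₂ t t.2)]
      simp only [Φ, ContinuousMap.coe_mk]
      module
    rw [dist_eq_norm, hdiff, norm_smul, Real.norm_of_nonneg (Real.exp_pos _).le]
    calc Real.exp (-(2 * K * (t - a))) * ‖∫ s in a..(t : ℝ), (g s (w v₁ s) - g s (w v₂ s))‖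
        ≤ Real.exp (-(2 * K * (t - a))) * (Real.exp (2 * K * (t - a)) * dist v₁ v₂ / 2) := by
          gcongr
          rw [hval] at hbound
          linarith [dist_nonneg (x := v₁) (y := v₂)]
      _ = (Real.exp (-(2 * K * (t - a))) * Real.exp (2 * K * (t - a))) * (dist v₁ v₂ / 2) := by
          ring
      _ = (1 / 2 : NNReal) * dist v₁ v₂ := by
          rw [← Real.exp_add, neg_add_cancel, Real.exp_zero]
          push_cast
          ring
  obtain ⟨v, hv, -⟩ := hΦ.exists_fixedPoint 0 (edist_ne_top _ _)
  refine ⟨w v, hw v, fun t ht => ?_⟩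
  have hvt : Φ v ⟨t, ht⟩ = v ⟨t, ht⟩ := by rw [hv]
  change Real.exp (2 * K * (t - a)) • v (projIcc a b hab t) = _
  rw [projIcc_of_mem hab ht, ← hvt]
  simp only [Φ, ContinuousMap.coe_mk]
  rw [smul_smul, ← Real.exp_add, add_neg_cancel, Real.exp_zero, one_smul]

/-- Grönwall's inequality in integral form with a constant forcing term. -/
theorem le_mul_exp_of_le_add_integral {e : ℝ → ℝ} {a b A K : ℝ} (hab : a ≤ b) (hK : 0 ≤ K)
    (he : ContinuousOn e (Icc a b)) (h : ∀ s ∈ Icc a b, e s ≤ A + K * ∫ τ in a..s, e τ) :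
    e b ≤ A * Real.exp (K * (b - a)) := by
  have hInt : IntervalIntegrable e volume a b := by
    refine ContinuousOn.intervalIntegrable ?_
    rwa [uIcc_of_le hab]
  have hcont : ContinuousOn (fun s => A + K * ∫ τ in a..s, e τ) (Icc a b) := by
    have hprim := intervalIntegral.continuousOn_primitive_interval' hInt left_mem_uIcc
    rw [uIcc_of_le hab] at hprim
    exact continuousOn_const.add (continuousOn_const.mul hprim)
  have hderiv : ∀ s ∈ Ico a b,
      HasDerivWithinAt (fun s => A + K * ∫ τ in a..s, e τ) (K * e s) (Ici s) s := by
    intro s hs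
    have hmem : Icc a b ∈ 𝓝[>] s := mem_of_superset (Ioc_mem_nhdsGT hs.2)
      fun y hy => ⟨hs.1.trans hy.1.le, hy.2⟩
    have hcs : ContinuousWithinAt e (Ioi s) s :=
      (he s ⟨hs.1, hs.2.le⟩).mono_of_mem_nhdsWithin hmem
    have hd : HasDerivWithinAt (fun s => ∫ τ in a..s, e τ) (e s) (Ici s) s :=
      intervalIntegral.integral_hasDerivWithinAt_right
        (hInt.mono_set (uIcc_subset_uIcc left_mem_uIcc (Icc_subset_uIcc ⟨hs.1, hs.2.le⟩)))
        (he.stronglyMeasurableAtFilter_nhdsWithin measurableSet_Icc s |>.filter_mono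
          (nhdsWithin_le_of_mem hmem)) hcs
    exact (hd.const_mul K).const_add A
  have hgr := le_gronwallBound_of_liminf_deriv_right_le (δ := A) (K := K) (ε := 0) hcont
    (fun s hs r hr => (hderiv s hs).liminf_right_slope_le hr) (by simp)
    (fun s hs => by
      rw [add_zero]
      exact mul_le_mul_of_nonneg_left (h s ⟨hs.1, hs.2.le⟩) hK) b (right_mem_Icc.2 hab)
  rw [gronwallBound_ε0] at hgr
  exact (h b (right_mem_Icc.2 hab)).trans hgr

/-- Along a switching signal, a Carathéodory function composed with a continuous curve is almost
everywhere strongly measurable on bounded intervals. -/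
theorem aestronglyMeasurable_comp_switching {X : Type*} [NormedAddCommGroup X]
    [MeasurableSpace X] [BorelSpace X] [SecondCountableTopology X] {σ : ℝ → ι}
    (hσ : IsSwitchingSignal σ) {g : ℝ → X → ι → X}
    (hmeas : ∀ ξ i, Measurable fun t => g t ξ i) (hcont : ∀ t i, Continuous fun ξ => g t ξ i)
    {w : ℝ → X} (hw : Continuous w) {b : ℝ} (hb : 0 < b) :
    AEStronglyMeasurable (fun s => g s (w s) (σ s)) (volume.restrict (Ico 0 b)) := by
  obtain ⟨n, t, ht0, -, htn, hconst⟩ := hσ b hb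
  have hsub : Ico 0 b ⊆ ⋃ i : Fin n, Ico (t i) (t (i + 1)) := by
    intro s hs
    have hs' := Ico_subset_biUnion_Ico n t ⟨ht0.trans_le hs.1, hs.2.trans_le htn⟩
    simp only [mem_iUnion, Finset.mem_range] at hs' ⊢
    obtain ⟨i, hi, hsi⟩ := hs'
    exact ⟨⟨i, hi⟩, hsi⟩
  refine AEStronglyMeasurable.mono_measure ?_ (Measure.restrict_mono hsub le_rfl)
  rw [aestronglyMeasurable_iUnion_iff]
  intro i
  have hunc : StronglyMeasurable (Function.uncurry fun ξ s => g s ξ (σ (t i))) :=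
    stronglyMeasurable_uncurry_of_continuous_of_stronglyMeasurable
      (fun s => hcont s _) fun ξ => (hmeas ξ _).stronglyMeasurable
  have hcomp : StronglyMeasurable fun s => g s (w s) (σ (t i)) :=
    hunc.comp_measurable (hw.measurable.prodMk measurable_id)
  refine hcomp.aestronglyMeasurable.congr ?_
  refine (ae_restrict_mem measurableSet_Ico).mono fun s hs => ?_
  simp only [hconst i i.2 s hs]

/-- A zero-input solution exists on all of `[t₀, T]` as soon as its norm is bounded a priori. -/
theorem exists_zeroInput_solution [NormedAddCommGroup Y] [ProperSpace X] [MeasurableSpace X]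
    [BorelSpace X] {f : ℝ → X → Y → ι → X} (hreg : Regular f) {γ : ℝ → ℝ} (hγ : γ 0 = 0)
    (hC1 : CondC1 f γ) (hC3 : CondC3 f) {σ : ℝ → ι} (hσ : IsSwitchingSignal σ) {t₀ T : ℝ}
    (ht₀ : 0 ≤ t₀) (hT : t₀ ≤ T) (ξ₀ : X) {B : ℝ}
    (hB : ∀ τ ∈ Icc t₀ T, ∀ z, IsSolution f (fun _ => (0 : Y)) σ (Icc t₀ τ) z → z t₀ = ξ₀ →
      ‖z τ‖ ≤ B) :
    ∃ z, IsSolution f (fun _ => (0 : Y)) σ (Icc t₀ T) z ∧ z t₀ = ξ₀ := by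
  obtain ⟨N, hNpos, hNmono, hN⟩ := hC1
  obtain ⟨-, hmeas, hcont⟩ := hreg
  set R : ℝ := max B ‖ξ₀‖ + 1 with hRdef
  have hR : 0 < R := by linarith [norm_nonneg ξ₀, le_max_right B ‖ξ₀‖]
  obtain ⟨L, hL, hlip⟩ := hC3 _ (isCompact_closedBall (0 : X) R)
  have hmem : ∀ ξ : X, radialRetraction R ξ ∈ Metric.closedBall (0 : X) R := fun ξ => by
    simpa using norm_radialRetraction_le hR ξ
  have hcont' : ∀ t i, Continuous fun ξ => f t ξ 0 i := fun t i =>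
    (hcont t i).comp (continuous_id.prodMk continuous_const)
  have hInt : ∀ w : ℝ → X, Continuous w → IntervalIntegrable
      (fun s => f s (radialRetraction R (w s)) 0 (σ s)) volume t₀ T := by
    intro w hw
    rw [intervalIntegrable_iff_integrableOn_Ioc_of_le hT]
    refine Integrable.of_bound (μ := volume.restrict (Ioc t₀ T)) ?_ (N R) ?_
    · refine (aestronglyMeasurable_comp_switching hσ (g := fun t ξ i => f t ξ 0 i)
        (fun ξ i => hmeas ξ 0 i) hcont' ((continuous_radialRetraction hR).comp hw)
        (b := T + 1) (by linarith)).mono_measure (Measure.restrict_mono ?_ le_rfl)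
      exact fun s hs => ⟨ht₀.trans hs.1.le, hs.2.trans_lt (lt_add_one T)⟩
    · refine (ae_restrict_mem measurableSet_Ioc).mono fun s hs => ?_
      refine (hN s (ht₀.trans hs.1.le) _ _ _).trans ?_
      rw [norm_zero, hγ, add_zero, mul_one]
      exact hNmono (norm_nonneg _) hR.le (norm_radialRetraction_le hR _)
  obtain ⟨z, hzc, hz⟩ := exists_integral_eq_of_lipschitz
    (g := fun s ξ => f s (radialRetraction R ξ) 0 (σ s)) (K := 2 * L + 1) hT (by linarith) hInt
    (fun s hs ξ ζ => by
      refine (hlip s (ht₀.trans hs.1) (σ s) _ (hmem ξ) _ (hmem ζ)).trans ?_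
      nlinarith [norm_radialRetraction_sub_le hR ξ ζ, norm_nonneg (ξ - ζ)]) ξ₀
  have hz₀ : z t₀ = ξ₀ := by simpa using hz t₀ (left_mem_Icc.2 hT)
  have hsol : ∀ τ ∈ Icc t₀ T, (∀ s ∈ Icc t₀ τ, ‖z s‖ ≤ R) →
      IsSolution f (fun _ => (0 : Y)) σ (Icc t₀ τ) z := by
    intro τ hτ hbd
    have heq : ∀ s ∈ Icc t₀ τ, f s (radialRetraction R (z s)) 0 (σ s) = f s (z s) 0 (σ s) :=
      fun s hs => by rw [radialRetraction_of_norm_le hR (hbd s hs)]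
    have hInt' : ∀ a ∈ Icc t₀ τ, ∀ b ∈ Icc t₀ τ, IntervalIntegrable
        (fun s => f s (radialRetraction R (z s)) 0 (σ s)) volume a b := fun a ha b hb =>
      (hInt z hzc).mono_set (uIcc_subset_uIcc (Icc_subset_uIcc ⟨ha.1, ha.2.trans hτ.2⟩)
        (Icc_subset_uIcc ⟨hb.1, hb.2.trans hτ.2⟩))
    refine ⟨ordConnected_Icc, fun s hs => ht₀.trans hs.1, ⟨t₀, left_mem_Icc.2 hτ.1⟩,
      hzc.continuousOn, fun a ha b hb => ?_, fun a ha b hb => ?_⟩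
    · refine (hInt' a ha b hb).congr ?_
      intro s hs
      exact heq s (ordConnected_Icc.uIcc_subset ha hb (uIoc_subset_uIcc hs))
    · rw [← intervalIntegral.integral_congr fun s hs =>
        heq s (ordConnected_Icc.uIcc_subset ha hb hs), hz a ⟨ha.1, ha.2.trans hτ.2⟩,
        hz b ⟨hb.1, hb.2.trans hτ.2⟩, add_assoc, intervalIntegral.integral_add_adjacent_intervals
          (hInt' _ (left_mem_Icc.2 hτ.1) _ ha) (hInt' _ ha _ hb)]
  have hlt : ∀ t ∈ Icc t₀ T, ‖z t‖ < R := by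
    by_contra! hex
    let A : Set ℝ := Icc t₀ T ∩ {s | R ≤ ‖z s‖}
    have hAc : IsCompact A := isCompact_Icc.inter_right (isClosed_le continuous_const hzc.norm)
    have hAne : A.Nonempty := hex
    obtain ⟨τ, ⟨hτ, hRτ⟩, hmin⟩ := hAc.exists_isLeast hAne
    have hbefore : ∀ s ∈ Ico t₀ τ, ‖z s‖ ≤ R := fun s hs => by
      by_contra! hs'
      exact absurd (hmin ⟨⟨hs.1, hs.2.le.trans hτ.2⟩, hs'.le⟩) (not_le.2 hs.2)
    have hne : t₀ ≠ τ := by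
      rintro rfl
      rw [mem_ofPred_eq, hz₀] at hRτ
      linarith [le_max_right B ‖ξ₀‖]
    have hbd : ∀ s ∈ Icc t₀ τ, ‖z s‖ ≤ R := by
      have hclosed : IsClosed {s | ‖z s‖ ≤ R} := isClosed_le hzc.norm continuous_const
      rw [← closure_Ico hne]
      exact closure_minimal hbefore hclosed
    have hτB := hB τ hτ z (hsol τ hτ hbd) hz₀
    rw [mem_ofPred_eq] at hRτ
    linarith [le_max_left B ‖ξ₀‖]
  exact ⟨z, hsol T (right_mem_Icc.2 hT) fun s hs => (hlt s hs).le, hz₀⟩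

/-- The gap between the input-driven and the zero-input vector field on a ball is at most `η` plus
a multiple of `χ` evaluated at the size of the input. -/
theorem exists_norm_sub_zeroInput_le {X : Type*} [NormedAddCommGroup X] [NormedAddCommGroup Y]
    {f : ℝ → X → Y → ι → X}
    {γ χ : ℝ → ℝ} (hγ : γ 0 = 0) (hC1 : CondC1 f γ) (hC2 : CondC2 f) (hχ : ClassK χ)
    (hχγ : ∀ r, 0 ≤ r → γ r ≤ χ r) {r η : ℝ} (hr : 0 < r) (hη : 0 < η) :
    ∃ κ, 0 < κ ∧ ∀ t, 0 ≤ t → ∀ (i : ι) (ξ : X) (μ : Y), ‖ξ‖ ≤ r →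
      ‖f t ξ μ i - f t ξ 0 i‖ ≤ η + κ * χ ‖μ‖ := by
  obtain ⟨N, hNpos, hNmono, hN⟩ := hC1
  obtain ⟨δ, hδ, hδf⟩ := hC2 r hr η hη
  obtain ⟨-, hχmono, hχ0⟩ := hχ
  have hχδ : 0 < χ δ := hχ0 ▸ hχmono self_mem_Ici hδ.le hδ
  have hNr : 0 < N r := hNpos r hr.le
  have hκ : 0 < N r * (2 / χ δ + 1) := by positivity
  refine ⟨N r * (2 / χ δ + 1), hκ, fun t ht i ξ μ hξ => ?_⟩
  have hχμ : 0 ≤ χ ‖μ‖ := hχ0 ▸ hχmono.monotoneOn self_mem_Ici (norm_nonneg μ) (norm_nonneg μ)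
  by_cases hμ : ‖μ‖ ≤ δ
  · exact (hδf t ht i ξ μ hξ hμ).le.trans (le_add_of_nonneg_right (mul_nonneg hκ.le hχμ))
  · have hNξ : N ‖ξ‖ ≤ N r := hNmono (norm_nonneg ξ) hr.le hξ
    have hN0 := hN t ht ξ 0 i
    rw [norm_zero, hγ, add_zero, mul_one] at hN0
    have hδμ : 1 ≤ χ ‖μ‖ / χ δ :=
      (one_le_div hχδ).2 (hχmono.monotoneOn hδ.le (norm_nonneg μ) (not_le.1 hμ).le)
    have hNμ : N ‖ξ‖ * (1 + γ ‖μ‖) ≤ N r * (1 + χ ‖μ‖) :=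
      (mul_le_mul_of_nonneg_left (by linarith [hχγ _ (norm_nonneg μ)])
        (hNpos _ (norm_nonneg ξ)).le).trans (mul_le_mul_of_nonneg_right hNξ (by linarith))
    calc ‖f t ξ μ i - f t ξ 0 i‖ ≤ ‖f t ξ μ i‖ + ‖f t ξ 0 i‖ := norm_sub_le _ _
      _ ≤ N r * (1 + χ ‖μ‖) + N r := add_le_add ((hN t ht ξ μ i).trans hNμ) (hN0.trans hNξ)
      _ = N r * (2 * 1 + χ ‖μ‖) := by ring
      _ ≤ N r * (2 * (χ ‖μ‖ / χ δ) + χ ‖μ‖) := by gcongr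
      _ = N r * (2 / χ δ + 1) * χ ‖μ‖ := by ring
      _ ≤ η + N r * (2 / χ δ + 1) * χ ‖μ‖ := le_add_of_nonneg_left hη.le

theorem IsInput.intervalIntegrable_classK [NormedAddCommGroup Y] [MeasurableSpace Y]
    [OpensMeasurableSpace Y] {u : ℝ → Y} (hu : IsInput u) {χ : ℝ → ℝ} (hχ : ClassK χ) {a b : ℝ}
    (ha : 0 ≤ a) (hab : a ≤ b) : IntervalIntegrable (fun s => χ ‖u s‖) volume a b := by
  obtain ⟨hum, hub⟩ := hu
  obtain ⟨hχc, hχmono, hχ0⟩ := hχ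
  obtain ⟨C, hC⟩ := hub b
  rw [intervalIntegrable_iff_integrableOn_Ioc_of_le hab]
  have hcont : Continuous fun s : ℝ => χ (max 0 s) :=
    hχc.comp_continuous (by fun_prop) fun s => le_max_left 0 s
  have hmeas : Measurable fun s => χ ‖u s‖ := by
    have hcomp := hcont.measurable.comp hum.norm
    simpa only [Function.comp_def, max_eq_right (norm_nonneg _)] using hcomp
  refine Measure.integrableOn_of_bounded (M := χ C) measure_Ioc_lt_top.ne
    hmeas.aestronglyMeasurable ?_
  filter_upwards [ae_restrict_mem measurableSet_Ioc, ae_restrict_of_ae hC] with s hs hCs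
  have hle := hCs ⟨ha.trans hs.1.le, hs.2⟩
  have hnn : 0 ≤ χ ‖u s‖ :=
    hχ0 ▸ hχmono.monotoneOn self_mem_Ici (norm_nonneg (u s)) (norm_nonneg (u s))
  rw [Real.norm_of_nonneg hnn]
  exact hχmono.monotoneOn (norm_nonneg _) ((norm_nonneg _).trans hle) hle

/-- Continuous dependence: a solution and a zero-input solution with the same initial state whose
vector fields differ by at most `φ` along the trajectory drift apart at most like
`(∫ φ) e^{L(t - t₀)}`. -/
theorem norm_sub_le_of_zeroInput [NormedAddCommGroup Y] {f : ℝ → X → Y → ι → X} {u : ℝ → Y}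
    {σ : ℝ → ι} {x z : ℝ → X} {t₀ t L : ℝ} (htt : t₀ ≤ t) (hL : 0 ≤ L) {φ : ℝ → ℝ}
    (hx : IsSolution f u σ (Icc t₀ t) x)
    (hz : IsSolution f (fun _ => (0 : Y)) σ (Icc t₀ t) z) (h₀ : z t₀ = x t₀)
    (hφ : IntervalIntegrable φ volume t₀ t)
    (hgap : ∀ s ∈ Icc t₀ t, ‖f s (x s) (u s) (σ s) - f s (x s) 0 (σ s)‖ ≤ φ s)
    (hlip : ∀ s ∈ Icc t₀ t,
      ‖f s (x s) 0 (σ s) - f s (z s) 0 (σ s)‖ ≤ L * ‖x s - z s‖) :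
    ‖x t - z t‖ ≤ (∫ s in t₀..t, φ s) * Real.exp (L * (t - t₀)) := by
  have hce : ContinuousOn (fun s => ‖x s - z s‖) (Icc t₀ t) :=
    (hx.continuousOn.sub hz.continuousOn).norm
  have hmem₀ : t₀ ∈ Icc t₀ t := left_mem_Icc.2 htt
  refine le_mul_exp_of_le_add_integral (e := fun s => ‖x s - z s‖) htt hL hce fun s hs => ?_
  have hsub : Icc t₀ s ⊆ Icc t₀ t := Icc_subset_Icc_right hs.2
  have hφs : IntervalIntegrable φ volume t₀ s :=
    hφ.mono_set (uIcc_subset_uIcc left_mem_uIcc (Icc_subset_uIcc hs))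
  have hes : IntervalIntegrable (fun τ => L * ‖x τ - z τ‖) volume t₀ s := by
    refine ContinuousOn.intervalIntegrable ?_
    rw [uIcc_of_le hs.1]
    exact continuousOn_const.mul (hce.mono hsub)
  have hdiff : x s - z s =
      ∫ τ in t₀..s, (f τ (x τ) (u τ) (σ τ) - f τ (z τ) 0 (σ τ)) := by
    rw [intervalIntegral.integral_sub (hx.intervalIntegrable _ hmem₀ _ hs)
      (hz.intervalIntegrable _ hmem₀ _ hs), hx.integral_eq _ hmem₀ _ hs,
      hz.integral_eq _ hmem₀ _ hs, h₀]
    abel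
  have hmono : ∫ τ in t₀..s, φ τ ≤ ∫ τ in t₀..t, φ τ := by
    refine intervalIntegral.integral_mono_interval le_rfl hs.1 hs.2 ?_ hφ
    exact (ae_restrict_mem measurableSet_Ioc).mono fun τ hτ =>
      (norm_nonneg _).trans (hgap τ ⟨hτ.1.le, hτ.2⟩)
  calc ‖x s - z s‖ ≤ ∫ τ in t₀..s, (φ τ + L * ‖x τ - z τ‖) := by
        rw [hdiff]
        refine intervalIntegral.norm_integral_le_of_norm_le hs.1
          (Eventually.of_forall fun τ hτ => ?_) (hφs.add hes)
        have hτ' : τ ∈ Icc t₀ t := hsub ⟨hτ.1.le, hτ.2⟩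
        exact (norm_sub_le_norm_sub_add_norm_sub _ _ _).trans
          (add_le_add (hgap τ hτ') (hlip τ hτ'))
    _ = (∫ τ in t₀..s, φ τ) + L * ∫ τ in t₀..s, ‖x τ - z τ‖ := by
        rw [intervalIntegral.integral_add hφs hes, intervalIntegral.integral_const_mul]
    _ ≤ (∫ τ in t₀..t, φ τ) + L * ∫ τ in t₀..s, ‖x τ - z τ‖ := by gcongr

end Auxiliary

/-- Lemma `0GAS`: under Assumption A, if the system is 0-GUAS w.r.t. `S`
with `KL`-estimate `β`, and `χ` is a class-`K∞` function with `χ ≥ γ` on `[0,∞)`, then for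
every `r > 0` there is `L = L(r) > 0` and for every `η > 0` there is `κ = κ(r,η) > 0` such
that every solution remaining in the ball of radius `r` satisfies
`|x(t)| ≤ β(|x(t₀)|, t−t₀) + [η (t−t₀) + κ ∫_{t₀}^t χ(|u|)] e^{L(t−t₀)}`. -/
theorem stmt8 {n m : ℕ} {Γ : Type*} [Nonempty Γ]
    (f : ℝ → EuclideanSpace ℝ (Fin n) → EuclideanSpace ℝ (Fin m) → Γ → EuclideanSpace ℝ (Fin n))
    (hreg : Regular f)
    (S : Set (ℝ → Γ)) (hS : ∀ σ ∈ S, IsSwitchingSignal σ)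
    (γ : ℝ → ℝ) (hA : AssumptionA f γ)
    (β : ℝ → ℝ → ℝ) (hβ : ClassKL β)
    (hGUAS : ∀ t₀, 0 ≤ t₀ → ∀ σ ∈ S, ∀ D x,
      IsMaximalSolution f (fun _ => (0 : EuclideanSpace ℝ (Fin m))) σ D x → t₀ ∈ D →
        ∀ t ∈ D, t₀ ≤ t → ‖x t‖ ≤ β ‖x t₀‖ (t - t₀))
    (χ : ℝ → ℝ) (hχ : ClassKInf χ) (hχγ : ∀ r, 0 ≤ r → γ r ≤ χ r) :
    ∀ r, 0 < r → ∃ L, 0 < L ∧ ∀ η, 0 < η → ∃ κ, 0 < κ ∧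
      ∀ t₀, 0 ≤ t₀ → ∀ u, IsInput u → ∀ σ ∈ S, ∀ D x,
        IsMaximalSolution f u σ D x → t₀ ∈ D →
          (∀ t ∈ D, t₀ ≤ t → ‖x t‖ ≤ r) →
          ∀ t ∈ D, t₀ ≤ t →
            ‖x t‖ ≤ β ‖x t₀‖ (t - t₀) +
              (η * (t - t₀) + κ * ∫ s in t₀..t, χ ‖u s‖) * Real.exp (L * (t - t₀)) := by
  intro r hr
  obtain ⟨⟨-, -, hγ0⟩, hC1, hC2, hC3⟩ := hA
  obtain ⟨L, hL, hlip⟩ :=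
    hC3 _ (isCompact_closedBall (0 : EuclideanSpace ℝ (Fin n)) (max r (β r 0)))
  refine ⟨L + 1, by linarith, fun η hη => ?_⟩
  obtain ⟨κ, hκ, hgap⟩ := exists_norm_sub_zeroInput_le hγ0 hC1 hC2 hχ.1 hχγ hr hη
  refine ⟨κ, hκ, fun t₀ ht₀ u hu σ hσ D x hx htD hbd t ht htt => ?_⟩
  have hsub : Icc t₀ t ⊆ D := hx.1.ordConnected.out htD ht
  have hzβ : ∀ τ, t₀ ≤ τ → ∀ z,
      IsSolution f (fun _ => (0 : EuclideanSpace ℝ (Fin m))) σ (Icc t₀ τ) z → z t₀ = x t₀ →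
      ∀ s ∈ Icc t₀ τ, ‖z s‖ ≤ β ‖x t₀‖ (s - t₀) := by
    intro τ hτ z hz hz₀ s hs
    obtain ⟨D', z', hmax, hD', heq⟩ := hz.exists_maximal_extension
    have hmem₀ : t₀ ∈ Icc t₀ τ := left_mem_Icc.2 hτ
    have := hGUAS t₀ ht₀ σ hσ D' z' hmax (hD' hmem₀) s (hD' hs) hs.1
    rwa [← heq hs, ← heq hmem₀, hz₀] at this
  have hβr : ∀ s, t₀ ≤ s → β ‖x t₀‖ (s - t₀) ≤ β r 0 := fun s hs =>
    ((hβ.2 _ (norm_nonneg _)).1 self_mem_Ici (sub_nonneg.2 hs) (sub_nonneg.2 hs)).trans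
      ((hβ.1 0 le_rfl).1.2.1.monotoneOn (norm_nonneg _) hr.le (hbd t₀ htD le_rfl))
  obtain ⟨z, hz, hz₀⟩ := exists_zeroInput_solution hreg hγ0 hC1 hC3 (hS σ hσ) ht₀ htt (x t₀)
    (B := β r 0) fun τ hτ z hz hz₀ =>
      (hzβ τ hτ.1 z hz hz₀ τ (right_mem_Icc.2 hτ.1)).trans (hβr τ hτ.1)
  have hχu := (hu.intervalIntegrable_classK hχ.1 ht₀ htt).const_mul κ
  have hdist := norm_sub_le_of_zeroInput (φ := fun s => η + κ * χ ‖u s‖) (L := L + 1) htt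
    (by linarith) (hx.1.mono ordConnected_Icc ⟨t₀, left_mem_Icc.2 htt⟩ hsub) hz hz₀
    (intervalIntegrable_const.add hχu)
    (fun s hs => hgap s (ht₀.trans hs.1) _ _ _ (hbd s (hsub hs) hs.1))
    (fun s hs => by
      refine (hlip s (ht₀.trans hs.1) (σ s) _ ?_ _ ?_).trans
        (mul_le_mul_of_nonneg_right (by linarith) (norm_nonneg _))
      · rw [mem_closedBall_zero_iff]
        exact (hbd s (hsub hs) hs.1).trans (le_max_left _ _)
      · rw [mem_closedBall_zero_iff]
        exact ((hzβ t htt z hz hz₀ s hs).trans (hβr s hs.1)).trans (le_max_right _ _))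
  rw [intervalIntegral.integral_add intervalIntegrable_const hχu,
    intervalIntegral.integral_const, intervalIntegral.integral_const_mul, smul_eq_mul,
    mul_comm (t - t₀) η] at hdist
  have hzt := hzβ t htt z hz hz₀ t (right_mem_Icc.2 htt)
  have htri : ‖x t‖ ≤ ‖z t‖ + ‖x t - z t‖ := norm_le_norm_add_norm_sub' (x t) (z t)
  linarith
end
end

section
/- Let Assumption A hold with γ as in (C1). If the switched system ẋ = f(t,x,u,σ) is 0-GUAS w.r.t. S and UBEBS w.r.t. S with UBEBS gain α, then there exist class-K functions α̃₁ and α̃₂ such that, with χ = max{α, γ}, every solution x ∈ T(t₀,u,σ) with t₀ ≥ 0, u ∈ U_m and σ ∈ S satisfies |x(t)| ≤ α̃₁(|x(t₀)|) + α̃₂(∫_{t₀}^t χ(|u(s)|) ds) for all t ≥ t₀ (i.e., the UBEBS estimate holds with additive constant c = 0 and gain χ). -/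
open MeasureTheory Set Filter Topology

noncomputable section

variable {Γ : Type*} {E : Type*} {F : Type*} {P : Type*}
  [NormedAddCommGroup E] [NormedSpace ℝ E]
  [NormedAddCommGroup F] [NormedSpace ℝ F]
  [NormedAddCommGroup P]
  [MeasurableSpace E] [MeasurableSpace F] [MeasurableSpace P]

theorem ClassK.nonneg {φ : ℝ → ℝ} (h : ClassK φ) {r : ℝ} (hr : 0 ≤ r) : 0 ≤ φ r := by
  have := h.2.1.monotoneOn (mem_Ici.2 le_rfl) (mem_Ici.2 hr) hr
  rwa [h.2.2] at this

theorem ClassK.pos {φ : ℝ → ℝ} (h : ClassK φ) {r : ℝ} (hr : 0 < r) : 0 < φ r := by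
  have := h.2.1 (mem_Ici.2 le_rfl) (mem_Ici.2 hr.le) hr
  rwa [h.2.2] at this

theorem ClassK.mono {φ : ℝ → ℝ} (h : ClassK φ) {r s : ℝ} (hr : 0 ≤ r) (hrs : r ≤ s) :
    φ r ≤ φ s :=
  h.2.1.monotoneOn (mem_Ici.2 hr) (mem_Ici.2 (hr.trans hrs)) hrs

/-- Arbitrarily small values of a class-`K` function are attained at positive arguments. -/
theorem ClassK.exists_pos_lt {φ : ℝ → ℝ} (h : ClassK φ) {ε : ℝ} (hε : 0 < ε) :
    ∃ η, 0 < η ∧ φ η < ε := by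
  have h0 : Tendsto φ (𝓝[>] 0) (𝓝 0) := by
    have := (h.1 0 (mem_Ici.2 le_rfl)).mono Ioi_subset_Ici_self
    rwa [ContinuousWithinAt, h.2.2] at this
  obtain ⟨η, hη, hη'⟩ := ((h0.eventually (gt_mem_nhds hε)).and self_mem_nhdsWithin).exists
  exact ⟨η, hη', hη⟩

/-- A set of pairs `(r, v)` whose `v`-component is small for small `r` and bounded by
`b r + c` with `b` of class `K` lies below the graph of a class-`K` function. -/
theorem exists_classK_dominating (A : Set (ℝ × ℝ)) (hA : ∀ p ∈ A, 0 ≤ p.1)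
    (hsmall : ∀ ε, 0 < ε → ∃ δ, 0 < δ ∧ ∀ p ∈ A, p.1 ≤ δ → p.2 ≤ ε)
    (b₁ b₂ : ℝ → ℝ) (c : ℝ) (hb₁ : ClassK b₁) (hb₂ : ClassK b₂) (hc : 0 ≤ c)
    (hbound : ∀ p ∈ A, p.2 ≤ b₁ p.1 + b₂ p.1 + c) :
    ∃ ω, ClassK ω ∧ ∀ p ∈ A, p.2 ≤ ω p.1 := by
  have hd : ∀ k : ℕ, ∃ δ, 0 < δ ∧ ∀ p ∈ A, p.1 ≤ δ → p.2 ≤ (1 / 2 : ℝ) ^ k :=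
    fun k => hsmall _ (by positivity)
  choose d hd0 hd using hd
  let T : ℕ → ℝ → ℝ := fun k r => (1 / 2 : ℝ) ^ k * max 0 (min 1 (r / d (k + 1)))
  have hT0 : ∀ k r, 0 ≤ T k r := fun k r => by positivity
  have hT1 : ∀ k r, T k r ≤ (1 / 2 : ℝ) ^ k := fun k r =>
    mul_le_of_le_one_right (by positivity) (max_le zero_le_one (min_le_left _ _))
  have hsum : Summable fun k : ℕ => (1 / 2 : ℝ) ^ k :=
    summable_geometric_of_lt_one (by norm_num) (by norm_num)
  have hTs : ∀ r, Summable fun k => T k r := fun r =>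
    Summable.of_nonneg_of_le (fun k => hT0 k r) (fun k => hT1 k r) hsum
  have hTc : Continuous fun r => ∑' k, T k r := by
    refine continuous_tsum (fun k => by fun_prop) hsum fun k r => ?_
    rw [Real.norm_of_nonneg (hT0 k r)]
    exact hT1 k r
  have hTm : Monotone fun r => ∑' k, T k r := fun r s hrs =>
    (hTs r).tsum_le_tsum (fun k => by
      have := (hd0 (k + 1)).le
      dsimp only [T]
      gcongr) (hTs s)
  have hTn : ∀ r, 0 ≤ ∑' k, T k r := fun r => tsum_nonneg fun k => hT0 k r
  refine ⟨fun r => b₁ r + b₂ r + (c / d 0 + 1) * r + ∑' k, T k r, ⟨?_, ?_, ?_⟩, ?_⟩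
  · exact ((hb₁.1.add hb₂.1).add (by fun_prop)).add hTc.continuousOn
  · intro r hr s hs hrs
    have h1 := hb₁.2.1 hr hs hrs
    have h2 := hb₂.2.1 hr hs hrs
    have h3 : (∑' k, T k r) ≤ ∑' k, T k s := hTm hrs.le
    have h4 : (c / d 0 + 1) * r ≤ (c / d 0 + 1) * s := by
      have := (hd0 0).le
      gcongr
    dsimp only
    linarith
  · simp [hb₁.2.2, hb₂.2.2, T]
  · rintro ⟨r, v⟩ hp
    have hr : 0 ≤ r := hA _ hp
    have h1 := hb₁.nonneg hr
    have h2 := hb₂.nonneg hr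
    have h3 := hTn r
    have hd00 := hd0 0
    have h4 : 0 ≤ (c / d 0 + 1) * r := by positivity
    dsimp only
    rcases le_or_gt v 0 with hv | hv
    · linarith
    rcases le_or_gt v 1 with hv1 | hv1
    · obtain ⟨k, hk1, hk2⟩ := exists_nat_pow_near_of_lt_one hv hv1
        (show (0 : ℝ) < 1 / 2 by norm_num) (by norm_num)
      have hrd : d (k + 1) < r := by
        by_contra hcon
        exact absurd (hd (k + 1) _ hp (not_lt.1 hcon)) (not_le.2 hk1)
      have hTk : T k r = (1 / 2 : ℝ) ^ k := by
        have : 1 ≤ r / d (k + 1) := (one_le_div (hd0 _)).2 hrd.le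
        simp [T, min_eq_left this]
      have : T k r ≤ ∑' k, T k r := (hTs r).le_tsum k fun j _ => hT0 j r
      linarith
    · have hrd : d 0 < r := by
        by_contra hcon
        have := hd 0 _ hp (not_lt.1 hcon)
        simp only [pow_zero] at this
        linarith
      have h5 : c ≤ c / d 0 * r := by
        rw [div_mul_eq_mul_div, le_div_iff₀ hd00]
        gcongr
      have h6 : v ≤ b₁ r + b₂ r + c := hbound _ hp
      linarith

/-- Grönwall's inequality in integral form. -/
theorem le_mul_exp_of_le_add_integral_s9 {w : ℝ → ℝ} {a b C L : ℝ} (hL : 0 ≤ L)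
    (hw : ContinuousOn w (Icc a b))
    (h : ∀ t ∈ Icc a b, w t ≤ C + L * ∫ s in a..t, w s) :
    ∀ t ∈ Icc a b, w t ≤ C * Real.exp (L * (t - a)) := by
  intro t ht
  have hab : a ≤ b := ht.1.trans ht.2
  obtain ⟨w', hw'c, hw'⟩ : ∃ w' : ℝ → ℝ, Continuous w' ∧ EqOn w' w (Icc a b) :=
    ⟨IccExtend hab ((Icc a b).domRestrict w), hw.domRestrict.Icc_extend',
      fun s hs => by simp [IccExtend_of_mem _ _ hs, domRestrict_apply]⟩
  have hint : ∀ t ∈ Icc a b, ∫ s in a..t, w' s = ∫ s in a..t, w s := fun t ht =>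
    intervalIntegral.integral_congr fun s hs => by
      rw [uIcc_of_le ht.1] at hs
      exact hw' ⟨hs.1, hs.2.trans ht.2⟩
  let V : ℝ → ℝ := fun t => C + L * ∫ s in a..t, w' s
  have hV : ∀ t, HasDerivAt V (L * w' t) t := fun t =>
    ((hw'c.integral_hasStrictDerivAt a t).hasDerivAt.const_mul L).const_add C
  have hwV : ∀ t ∈ Icc a b, w' t ≤ V t := fun t ht => by
    dsimp only [V]
    rw [hint t ht, hw' ht]
    exact h t ht
  have key := le_gronwallBound_of_liminf_deriv_right_le (f := V) (f' := fun t => L * w' t)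
    (δ := C) (K := L) (ε := 0) (a := a) (b := b)
    (fun t _ => (hV t).continuousAt.continuousWithinAt)
    (fun t _ r hr => by
      have := (hV t).hasDerivWithinAt (s := Ici t)
      exact (this.liminf_right_slope_le hr).mono fun z hz => by
        simpa [slope_def_field, div_eq_inv_mul] using hz)
    (by simp [V]) (fun t ht => by
      have := hwV t ⟨ht.1, ht.2.le⟩
      rw [add_zero]
      gcongr) t ht
  rw [gronwallBound_ε0] at key
  rw [← hw' ht]
  exact (hwV t ht).trans key

/-- Every Carathéodory solution extends to a maximally defined one. -/
theorem IsSolution.exists_isMaximalSolution {X Y Λ : Type*} [NormedAddCommGroup X]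
    [NormedSpace ℝ X] [NormedAddCommGroup Y] [NormedSpace ℝ Y] [MeasurableSpace X]
    [MeasurableSpace Y] {f : ℝ → X → Y → Λ → X} {u : ℝ → Y} {σ : ℝ → Λ} {D : Set ℝ} {x : ℝ → X}
    (h : IsSolution f u σ D x) :
    ∃ D' x', IsMaximalSolution f u σ D' x' ∧ D ⊆ D' ∧ EqOn x x' D := by
  let Q := {p : Set ℝ × (ℝ → X) // IsSolution f u σ p.1 p.2 ∧ D ⊆ p.1 ∧ EqOn x p.2 D}
  let r : Q → Q → Prop := fun p q => p.1.1 ⊆ q.1.1 ∧ EqOn p.1.2 q.1.2 p.1.1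
  have rtrans : ∀ {p q s : Q}, r p q → r q s → r p s := fun {p q s} h1 h2 =>
    ⟨h1.1.trans h2.1, fun t ht => (h1.2 ht).trans (h2.2 (h1.1 ht))⟩
  have rrefl : ∀ p : Q, r p p := fun p => ⟨Subset.rfl, fun t _ => rfl⟩
  have hchain : ∀ c : Set Q, IsChain r c → ∃ ub, ∀ p ∈ c, r p ub := by
    intro c hc
    rcases c.eq_empty_or_nonempty with rfl | ⟨p₀, hp₀⟩
    · exact ⟨⟨(D, x), h, Subset.rfl, fun t _ => rfl⟩, by simp⟩
    have hdir : ∀ p ∈ c, ∀ q ∈ c, ∃ s ∈ c, r p s ∧ r q s := by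
      intro p hp q hq
      by_cases hpq : p = q
      · exact ⟨p, hp, rrefl p, hpq ▸ rrefl p⟩
      · rcases hc hp hq hpq with h' | h'
        · exact ⟨q, hq, h', rrefl q⟩
        · exact ⟨p, hp, rrefl p, h'⟩
    classical
    let U : Set ℝ := {t | ∃ p ∈ c, t ∈ p.1.1}
    let y : ℝ → X := fun t => if ht : ∃ p ∈ c, t ∈ p.1.1 then ht.choose.1.2 t else 0
    have hy : ∀ p ∈ c, EqOn p.1.2 y p.1.1 := by
      intro p hp t ht
      have hex : ∃ p ∈ c, t ∈ p.1.1 := ⟨p, hp, ht⟩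
      have hyt : y t = hex.choose.1.2 t := dif_pos hex
      obtain ⟨s, -, h1, h2⟩ := hdir p hp _ hex.choose_spec.1
      rw [hyt, h1.2 ht, h2.2 hex.choose_spec.2]
    have hsub : ∀ p ∈ c, p.1.1 ⊆ U := fun p hp t ht => ⟨p, hp, ht⟩
    have hpair : ∀ a ∈ U, ∀ b ∈ U, ∃ p ∈ c, a ∈ p.1.1 ∧ b ∈ p.1.1 := by
      rintro a ⟨p, hp, ha⟩ b ⟨q, hq, hb⟩
      obtain ⟨s, hs, h1, h2⟩ := hdir p hp q hq
      exact ⟨s, hs, h1.1 ha, h2.1 hb⟩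
    have hU : IsSolution f u σ U y := by
      refine ⟨⟨?_⟩, ?_, ?_, ?_, ?_, ?_⟩
      · intro a ha b hb
        obtain ⟨p, hp, ha', hb'⟩ := hpair a ha b hb
        exact (p.2.1.ordConnected.out ha' hb').trans (hsub p hp)
      · rintro t ⟨p, hp, ht⟩
        exact p.2.1.subset_Ici ht
      · obtain ⟨t, ht⟩ := p₀.2.1.nonempty
        exact ⟨t, p₀, hp₀, ht⟩
      · intro d hd
        have hleft : ∃ e ∈ U, ∃ o : Set ℝ, IsOpen o ∧ d ∈ o ∧ ∀ s ∈ o ∩ U, e ≤ s := by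
          by_cases hex : ∃ e ∈ U, e < d
          · obtain ⟨e, he, hed⟩ := hex
            exact ⟨e, he, Ioi e, isOpen_Ioi, hed, fun s hs => le_of_lt hs.1⟩
          · push Not at hex
            exact ⟨d, hd, univ, isOpen_univ, mem_univ d, fun s hs => hex s hs.2⟩
        have hright : ∃ e ∈ U, ∃ o : Set ℝ, IsOpen o ∧ d ∈ o ∧ ∀ s ∈ o ∩ U, s ≤ e := by
          by_cases hex : ∃ e ∈ U, d < e
          · obtain ⟨e, he, hed⟩ := hex
            exact ⟨e, he, Iio e, isOpen_Iio, hed, fun s hs => le_of_lt hs.1⟩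
          · push Not at hex
            exact ⟨d, hd, univ, isOpen_univ, mem_univ d, fun s hs => hex s hs.2⟩
        obtain ⟨e₁, he₁, o₁, ho₁, hd₁, h₁⟩ := hleft
        obtain ⟨e₂, he₂, o₂, ho₂, hd₂, h₂⟩ := hright
        obtain ⟨p, hp, hp₁, hp₂⟩ := hpair e₁ he₁ e₂ he₂
        have hsubset : (o₁ ∩ o₂) ∩ U ⊆ p.1.1 := fun s hs =>
          p.2.1.ordConnected.out hp₁ hp₂ ⟨h₁ s ⟨hs.1.1, hs.2⟩, h₂ s ⟨hs.1.2, hs.2⟩⟩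
        have hmem : p.1.1 ∈ 𝓝[U] d :=
          mem_nhdsWithin.2 ⟨o₁ ∩ o₂, ho₁.inter ho₂, ⟨hd₁, hd₂⟩, hsubset⟩
        have hcont : ContinuousOn y p.1.1 := p.2.1.continuousOn.congr (hy p hp).symm
        exact (hcont d (hsubset ⟨⟨hd₁, hd₂⟩, hd⟩)).mono_of_mem_nhdsWithin hmem
      · intro a ha b hb
        obtain ⟨p, hp, ha', hb'⟩ := hpair a ha b hb
        refine (p.2.1.intervalIntegrable a ha' b hb').congr fun s hs => ?_
        have := p.2.1.ordConnected.uIcc_subset ha' hb' (uIoc_subset_uIcc hs)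
        simp only [hy p hp this]
      · intro a ha b hb
        obtain ⟨p, hp, ha', hb'⟩ := hpair a ha b hb
        rw [← hy p hp ha', ← hy p hp hb', p.2.1.integral_eq a ha' b hb']
        congr 1
        refine intervalIntegral.integral_congr fun s hs => ?_
        have := p.2.1.ordConnected.uIcc_subset ha' hb' hs
        simp only [hy p hp this]
    refine ⟨⟨(U, y), hU, p₀.2.2.1.trans (hsub p₀ hp₀), fun t ht => ?_⟩,
      fun p hp => ⟨hsub p hp, hy p hp⟩⟩
    rw [p₀.2.2.2 ht]
    exact hy p₀ hp₀ (p₀.2.2.1 ht)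
  obtain ⟨M, hM⟩ := exists_maximal_of_chains_bounded hchain rtrans
  refine ⟨M.1.1, M.1.2, ⟨M.2.1, fun D' x' h' hsub heq => ?_⟩, M.2.2.1, M.2.2.2⟩
  exact (hM ⟨(D', x'), h', M.2.2.1.trans hsub,
    fun t ht => (M.2.2.2 ht).trans (heq (M.2.2.1 ht))⟩ ⟨hsub, heq⟩).1

/-- Along a continuous curve, the zero-input vector field selected by a switching signal is
measurable on bounded time intervals. -/
theorem Regular.aestronglyMeasurable_comp {X Y Λ : Type*} [NormedAddCommGroup X]
    [NormedSpace ℝ X] [NormedAddCommGroup Y] [NormedSpace ℝ Y] [MeasurableSpace X] [BorelSpace X]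
    [SecondCountableTopology X] [MeasurableSpace Y] {f : ℝ → X → Y → Λ → X} (hf : Regular f)
    {σ : ℝ → Λ} (hσ : IsSwitchingSignal σ) {y : ℝ → X} (hy : Continuous y) {b : ℝ} (hb : 0 < b) :
    AEStronglyMeasurable (fun s => f s (y s) 0 (σ s)) (volume.restrict (Ico 0 b)) := by
  have hi : ∀ i : Λ, Measurable fun s => f s (y s) 0 i := by
    intro i
    have h := measurable_uncurry_of_continuous_of_measurable (u := fun ξ s => f s ξ 0 i)
      (fun s => (hf.2.2 s i).comp (Continuous.prodMk_left 0)) fun ξ => hf.2.1 ξ 0 i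
    exact h.comp (hy.measurable.prodMk measurable_id)
  obtain ⟨k, t, ht0, htlt, htb, ht⟩ := hσ b hb
  have hpieces : ∀ j ≤ k, 0 ≤ t j ∧
      AEStronglyMeasurable (fun s => f s (y s) 0 (σ s)) (volume.restrict (Ico 0 (t j))) := by
    intro j
    induction j with
    | zero => simp [ht0]
    | succ j ih =>
      intro hj
      obtain ⟨h0, hm⟩ := ih (by omega)
      have hlt := htlt j (by omega)
      refine ⟨h0.trans hlt.le, ?_⟩
      rw [← Ico_union_Ico_eq_Ico h0 hlt.le, aestronglyMeasurable_union_iff]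
      refine ⟨hm, ((hi (σ (t j))).aestronglyMeasurable).congr ?_⟩
      filter_upwards [ae_restrict_mem measurableSet_Ico] with s hs
      rw [ht j (by omega) s hs]
  exact (hpieces k le_rfl).2.mono_measure (Measure.restrict_mono (Ico_subset_Ico_right htb) le_rfl)

/-- Picard's theorem for a bounded, globally Lipschitz right-hand side that is merely measurable
in time. -/
theorem exists_integral_solution_of_lipschitz {X : Type*} [NormedAddCommGroup X]
    [NormedSpace ℝ X] [CompleteSpace X] {G : ℝ → X → X} {a b L M : ℝ} (hab : a ≤ b) (hL : 0 ≤ L)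
    (hGL : ∀ s ∈ Icc a b, ∀ ξ ξ', ‖G s ξ - G s ξ'‖ ≤ L * ‖ξ - ξ'‖)
    (hGM : ∀ s ∈ Icc a b, ∀ ξ, ‖G s ξ‖ ≤ M)
    (hmeas : ∀ y : ℝ → X, Continuous y →
      AEStronglyMeasurable (fun s => G s (y s)) (volume.restrict (Icc a b))) (x₀ : X) :
    ∃ z : ℝ → X, Continuous z ∧
      IntervalIntegrable (fun s => G s (z s)) volume a b ∧
      ∀ t ∈ Icc a b, z t = x₀ + ∫ s in a..t, G s (z s) := by
  have hint : ∀ y : ℝ → X, Continuous y →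
      IntervalIntegrable (fun s => G s (y s)) volume a b := by
    intro y hy
    rw [intervalIntegrable_iff_integrableOn_Icc_of_le hab]
    refine IntegrableOn.of_bound measure_Icc_lt_top (hmeas y hy) M ?_
    filter_upwards [ae_restrict_mem measurableSet_Icc] with s hs using hGM s hs _
  let l : ℝ := 2 * L + 1
  have hl : 0 < l := by positivity
  let Z : C(Icc a b, X) → ℝ → X := fun y s => Real.exp (l * (s - a)) • IccExtend hab y s
  have hZ : ∀ y, Continuous (Z y) := fun y =>
    (by fun_prop : Continuous fun s => Real.exp (l * (s - a))).smul y.continuous.Icc_extend'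
  have hsubint : ∀ y : ℝ → X, Continuous y → ∀ t ∈ Icc a b,
      IntervalIntegrable (fun s => G s (y s)) volume a t := fun y hy t ht =>
    (hint y hy).mono_set (by
      rw [uIcc_of_le ht.1, uIcc_of_le hab]
      exact Icc_subset_Icc_right ht.2)
  have hprim : ∀ y, ContinuousOn (fun t => ∫ s in a..t, G s (Z y s)) (Icc a b) := by
    intro y
    have := intervalIntegral.continuousOn_primitive_interval' (hint _ (hZ y)) left_mem_uIcc
    rwa [uIcc_of_le hab] at this
  let Q : C(Icc a b, X) → C(Icc a b, X) := fun y =>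
    ⟨fun t => Real.exp (-(l * (t - a))) • (x₀ + ∫ s in a..(t : ℝ), G s (Z y s)), by
      have := (hprim y).domRestrict
      exact (by fun_prop : Continuous fun t : Icc a b => Real.exp (-(l * ((t : ℝ) - a)))).smul
        (continuous_const.add this)⟩
  have hexp : ∀ t, ∫ s in a..t, Real.exp (l * (s - a)) =
      Real.exp (l * (t - a)) / l - 1 / l := by
    intro t
    rw [intervalIntegral.integral_eq_sub_of_hasDerivAt
      (f := fun s => Real.exp (l * (s - a)) / l) (fun s _ => ?_)
      (Continuous.intervalIntegrable (by fun_prop) _ _)]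
    · simp
    · have := ((((hasDerivAt_id s).sub_const a).const_mul l).exp).div_const l
      simpa [hl.ne'] using this
  have hQ : ContractingWith (1 / 2) Q := by
    refine ⟨by norm_num, LipschitzWith.of_dist_le_mul fun y z => ?_⟩
    rw [ContinuousMap.dist_le (by positivity)]
    intro t
    have hdiff : ‖(∫ s in a..(t : ℝ), G s (Z y s)) - ∫ s in a..(t : ℝ), G s (Z z s)‖ ≤
        ∫ s in a..(t : ℝ), L * dist y z * Real.exp (l * (s - a)) := by
      rw [← intervalIntegral.integral_sub (hsubint _ (hZ y) t t.2) (hsubint _ (hZ z) t t.2)]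
      refine intervalIntegral.norm_integral_le_of_norm_le t.2.1 (ae_of_all _ fun s hs => ?_)
        (Continuous.intervalIntegrable (by fun_prop) _ _)
      have hs' : s ∈ Icc a b := ⟨hs.1.le, hs.2.trans t.2.2⟩
      refine (hGL s hs' _ _).trans ?_
      have : ‖Z y s - Z z s‖ ≤ Real.exp (l * (s - a)) * dist y z := by
        dsimp only [Z]
        rw [← smul_sub, norm_smul, Real.norm_of_nonneg (Real.exp_nonneg _),
          IccExtend_of_mem _ _ hs', IccExtend_of_mem _ _ hs', ← dist_eq_norm]
        gcongr
        exact ContinuousMap.dist_apply_le_dist _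
      calc L * ‖Z y s - Z z s‖ ≤ L * (Real.exp (l * (s - a)) * dist y z) := by gcongr
        _ = _ := by ring
    rw [intervalIntegral.integral_const_mul, hexp] at hdiff
    change dist (Real.exp (-(l * (t - a))) • (x₀ + ∫ s in a..(t : ℝ), G s (Z y s)))
      (Real.exp (-(l * (t - a))) • (x₀ + ∫ s in a..(t : ℝ), G s (Z z s))) ≤ _
    rw [dist_eq_norm, ← smul_sub, add_sub_add_left_eq_sub, norm_smul,
      Real.norm_of_nonneg (Real.exp_nonneg _)]
    have hLl : L / l ≤ 1 / 2 := by
      rw [div_le_div_iff₀ hl (by norm_num)]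
      dsimp only [l]
      linarith
    have hd0 : 0 ≤ dist y z := dist_nonneg
    calc Real.exp (-(l * (t - a))) * _
        ≤ Real.exp (-(l * (t - a))) * (L * dist y z * (Real.exp (l * (t - a)) / l - 1 / l)) := by
          gcongr
      _ ≤ Real.exp (-(l * (t - a))) * (L * dist y z * (Real.exp (l * (t - a)) / l)) := by
          gcongr
          have : 0 ≤ 1 / l := by positivity
          linarith
      _ = (L / l) * dist y z := by
          rw [Real.exp_neg]
          field_simp
      _ ≤ _ := by
          push_cast
          gcongr
  have : Nonempty C(Icc a b, X) := ⟨ContinuousMap.const _ 0⟩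
  let y := ContractingWith.fixedPoint Q hQ
  have hy : Q y = y := hQ.fixedPoint_isFixedPt
  refine ⟨Z y, hZ y, hint _ (hZ y), fun t ht => ?_⟩
  have h1 : y ⟨t, ht⟩ =
      Real.exp (-(l * (t - a))) • (x₀ + ∫ s in a..t, G s (Z y s)) := by
    conv_lhs => rw [← hy]
    rfl
  have h2 : Z y t = Real.exp (l * (t - a)) • y ⟨t, ht⟩ := by
    dsimp only [Z]
    rw [IccExtend_of_mem _ _ ht]
  rw [h2, h1, smul_smul, ← Real.exp_add]
  simp

/-- The cutoff of a field that is Lipschitz and bounded on a ball is globally Lipschitz. -/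
theorem norm_cutoff_smul_sub_le {X : Type*} [NormedAddCommGroup X] [NormedSpace ℝ X]
    {g : X → X} {R L M : ℝ} (hL : 0 ≤ L) (hM : 0 ≤ M)
    (hgL : ∀ ξ ξ', ‖ξ‖ ≤ R + 1 → ‖ξ'‖ ≤ R + 1 → ‖g ξ - g ξ'‖ ≤ L * ‖ξ - ξ'‖)
    (hgM : ∀ ξ, ‖ξ‖ ≤ R + 1 → ‖g ξ‖ ≤ M) (ξ ξ' : X) :
    ‖max 0 (min 1 (R + 1 - ‖ξ‖)) • g ξ - max 0 (min 1 (R + 1 - ‖ξ'‖)) • g ξ'‖ ≤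
      (L + M) * ‖ξ - ξ'‖ := by
  have hcl : ∀ ζ ζ' : X,
      |max 0 (min 1 (R + 1 - ‖ζ‖)) - max 0 (min 1 (R + 1 - ‖ζ'‖))| ≤ ‖ζ - ζ'‖ := by
    intro ζ ζ'
    have h1 := abs_max_sub_max_le_abs (min 1 (R + 1 - ‖ζ‖)) (min 1 (R + 1 - ‖ζ'‖)) 0
    have h2 := abs_min_sub_min_le_max 1 (R + 1 - ‖ζ‖) 1 (R + 1 - ‖ζ'‖)
    have h3 : |R + 1 - ‖ζ‖ - (R + 1 - ‖ζ'‖)| ≤ ‖ζ - ζ'‖ := by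
      rw [sub_sub_sub_cancel_left, abs_sub_comm]
      exact abs_norm_sub_norm_le ζ ζ'
    rw [max_comm 0, max_comm 0]
    refine h1.trans (h2.trans (max_le (by simp) h3))
  have hcout : ∀ ζ : X, R + 1 < ‖ζ‖ → max 0 (min 1 (R + 1 - ‖ζ‖)) = 0 := fun ζ hζ =>
    max_eq_left ((min_le_right _ _).trans (by linarith))
  have hone : ∀ ζ ζ' : X, ‖ζ‖ ≤ R + 1 → R + 1 < ‖ζ'‖ →
      ‖max 0 (min 1 (R + 1 - ‖ζ‖)) • g ζ‖ ≤ (L + M) * ‖ζ - ζ'‖ := by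
    intro ζ ζ' hζ hζ'
    have h1 := hcl ζ ζ'
    rw [hcout ζ' hζ', sub_zero] at h1
    rw [norm_smul, Real.norm_eq_abs]
    calc _ ≤ ‖ζ - ζ'‖ * M := by
          gcongr
          exact hgM ζ hζ
      _ ≤ _ := by nlinarith [norm_nonneg (ζ - ζ')]
  rcases le_or_gt ‖ξ‖ (R + 1) with h | h <;> rcases le_or_gt ‖ξ'‖ (R + 1) with h' | h'
  · have hc1 : |max 0 (min 1 (R + 1 - ‖ξ‖))| ≤ 1 := by
      rw [abs_of_nonneg (le_max_left _ _)]
      exact max_le zero_le_one (min_le_left _ _)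
    have hsplit : max 0 (min 1 (R + 1 - ‖ξ‖)) • g ξ - max 0 (min 1 (R + 1 - ‖ξ'‖)) • g ξ' =
        max 0 (min 1 (R + 1 - ‖ξ‖)) • (g ξ - g ξ') +
          (max 0 (min 1 (R + 1 - ‖ξ‖)) - max 0 (min 1 (R + 1 - ‖ξ'‖))) • g ξ' := by
      rw [smul_sub, sub_smul]
      abel
    rw [hsplit]
    refine (norm_add_le _ _).trans ?_
    rw [norm_smul, norm_smul, Real.norm_eq_abs, Real.norm_eq_abs]
    calc _ ≤ 1 * (L * ‖ξ - ξ'‖) + ‖ξ - ξ'‖ * M := by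
          gcongr
          · exact hgL ξ ξ' h h'
          · exact hcl ξ ξ'
          · exact hgM ξ' h'
      _ = _ := by ring
  · rw [hcout ξ' h', zero_smul, sub_zero]
    exact hone ξ ξ' h h'
  · rw [hcout ξ h, zero_smul, zero_sub, norm_neg, norm_sub_rev]
    exact hone ξ' ξ h' h
  · rw [hcout ξ h, hcout ξ' h', zero_smul, zero_smul, sub_zero, norm_zero]
    positivity

/-- Existence of a zero-input solution on a bounded interval under an a priori bound on the
maximally defined ones. -/
theorem exists_zero_input_solution {X Y Λ : Type*} [NormedAddCommGroup X]
    [NormedSpace ℝ X] [ProperSpace X] [NormedAddCommGroup Y] [NormedSpace ℝ Y]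
    [MeasurableSpace X] [BorelSpace X] [MeasurableSpace Y] {f : ℝ → X → Y → Λ → X}
    (hf : Regular f) {γ : ℝ → ℝ} (hA : AssumptionA f γ) {σ : ℝ → Λ} (hσ : IsSwitchingSignal σ)
    {a b R : ℝ} (ha : 0 ≤ a) (hab : a ≤ b) {ξ : X} (hξ : ‖ξ‖ ≤ R)
    (hprior : ∀ D z, IsMaximalSolution f (fun _ => (0 : Y)) σ D z → a ∈ D → z a = ξ →
      ∀ t ∈ D, a ≤ t → ‖z t‖ < R) :
    ∃ D z, IsMaximalSolution f (fun _ => (0 : Y)) σ D z ∧ Icc a b ⊆ D ∧ z a = ξ := by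
  obtain ⟨hγ, ⟨N, hN0, hNm, hN⟩, -, hC3⟩ := hA
  have hR : 0 ≤ R := (norm_nonneg ξ).trans hξ
  obtain ⟨L, hL, hLip⟩ := hC3 (Metric.closedBall 0 (R + 1)) (isCompact_closedBall _ _)
  have hM : ∀ s, 0 ≤ s → ∀ ζ, ‖ζ‖ ≤ R + 1 → ‖f s ζ 0 (σ s)‖ ≤ N (R + 1) := by
    intro s hs ζ hζ
    have h := hN s hs ζ 0 (σ s)
    rw [norm_zero, hγ.2.2, add_zero, mul_one] at h
    exact h.trans (hNm (norm_nonneg ζ) (mem_Ici.2 (by linarith)) hζ)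
  let cut : X → ℝ := fun ζ => max 0 (min 1 (R + 1 - ‖ζ‖))
  have hcut1 : ∀ ζ, ‖ζ‖ ≤ R → cut ζ = 1 := by
    intro ζ hζ
    dsimp only [cut]
    rw [min_eq_left (by linarith), max_eq_right zero_le_one]
  let G : ℝ → X → X := fun s ζ => cut ζ • f s ζ 0 (σ s)
  have hN0' : 0 ≤ N (R + 1) := (hN0 _ (by linarith)).le
  obtain ⟨z, hzc, hzi, hz⟩ := exists_integral_solution_of_lipschitz (G := G) (M := N (R + 1))
    hab (add_nonneg hL hN0')
    (fun s hs => norm_cutoff_smul_sub_le (g := fun ζ => f s ζ 0 (σ s)) hL hN0'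
      (fun ζ ζ' hζ hζ' => hLip s (ha.trans hs.1) (σ s) ζ (by simpa using hζ) ζ' (by simpa using hζ'))
      (hM s (ha.trans hs.1)))
    (fun s hs ζ => by
      dsimp only [G]
      rcases le_or_gt ‖ζ‖ (R + 1) with hζ | hζ
      · rw [norm_smul, Real.norm_of_nonneg (le_max_left _ _)]
        calc _ ≤ 1 * N (R + 1) := by
              gcongr
              · exact max_le zero_le_one (min_le_left _ _)
              · exact hM s (ha.trans hs.1) ζ hζ
          _ = _ := one_mul _
      · have : cut ζ = 0 := max_eq_left ((min_le_right _ _).trans (by linarith))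
        rw [this, zero_smul, norm_zero]
        exact hN0')
    (fun y hy => by
      have h1 := hf.aestronglyMeasurable_comp hσ hy (b := b + 1) (by linarith)
      have h2 : Continuous fun s => cut (y s) := by fun_prop
      exact h2.aestronglyMeasurable.smul (h1.mono_measure (Measure.restrict_mono
        (show Icc a b ⊆ Ico 0 (b + 1) from
          fun s hs => ⟨ha.trans hs.1, by linarith [hs.2]⟩) le_rfl))) ξ
  have hza : z a = ξ := by simpa using hz a ⟨le_rfl, hab⟩
  have hsol : ∀ t ∈ Icc a b, (∀ s ∈ Icc a t, ‖z s‖ ≤ R) →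
      IsSolution f (fun _ => (0 : Y)) σ (Icc a t) z := by
    intro t ht hzR
    have hG : EqOn (fun s => G s (z s)) (fun s => f s (z s) 0 (σ s)) (Icc a t) := by
      intro s hs
      simp only [G, hcut1 _ (hzR s hs), one_smul]
    have hi : ∀ c ∈ Icc a t, ∀ d ∈ Icc a t,
        IntervalIntegrable (fun s => G s (z s)) volume c d := fun c hc d hd =>
      hzi.mono_set (by
        rw [uIcc_of_le hab]
        exact ordConnected_Icc.uIcc_subset ⟨hc.1, hc.2.trans ht.2⟩ ⟨hd.1, hd.2.trans ht.2⟩)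
    refine ⟨ordConnected_Icc, fun s hs => ha.trans hs.1, ⟨a, le_rfl, ht.1⟩, hzc.continuousOn,
      fun c hc d hd => ?_, fun c hc d hd => ?_⟩
    · exact (hi c hc d hd).congr fun s hs =>
        hG (ordConnected_Icc.uIcc_subset hc hd (uIoc_subset_uIcc hs))
    · rw [← intervalIntegral.integral_congr (hG.mono (ordConnected_Icc.uIcc_subset hc hd)),
        hz c ⟨hc.1, hc.2.trans ht.2⟩, hz d ⟨hd.1, hd.2.trans ht.2⟩, add_assoc,
        intervalIntegral.integral_add_adjacent_intervals (hi a ⟨le_rfl, ht.1⟩ c hc) (hi c hc d hd)]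
  have hlevel : ∀ t ∈ Icc a b, R < ‖z t‖ → ∃ s ∈ Icc a t, ‖z s‖ = R := by
    intro t ht htR
    exact intermediate_value_Icc ht.1 hzc.norm.continuousOn ⟨by rwa [hza], htR.le⟩
  have hempty : ¬ ∃ t ∈ Icc a b, ‖z t‖ = R := by
    intro hex
    have hcomp : IsCompact {t ∈ Icc a b | ‖z t‖ = R} :=
      isCompact_Icc.inter_right (isClosed_eq hzc.norm continuous_const)
    obtain ⟨t, ⟨ht, htR⟩, hmin⟩ := hcomp.exists_isLeast hex
    have hle : ∀ s ∈ Icc a t, ‖z s‖ ≤ R := by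
      intro s hs
      by_contra hcon
      have hs' : s ∈ Icc a b := ⟨hs.1, hs.2.trans ht.2⟩
      obtain ⟨r, hr, hrR⟩ := hlevel s hs' (not_le.1 hcon)
      have hts : t ≤ s := (hmin ⟨⟨hr.1, hr.2.trans hs'.2⟩, hrR⟩).trans hr.2
      rw [le_antisymm hs.2 hts, htR] at hcon
      exact hcon le_rfl
    obtain ⟨D, z', hmax, hsub, heq⟩ := (hsol t ht hle).exists_isMaximalSolution
    have hat : a ∈ Icc a t := ⟨le_rfl, ht.1⟩
    have htt : t ∈ Icc a t := ⟨ht.1, le_rfl⟩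
    have := hprior D z' hmax (hsub hat) (by rw [← heq hat, hza]) t (hsub htt) ht.1
    rw [← heq htt, htR] at this
    exact lt_irrefl _ this
  have hle : ∀ s ∈ Icc a b, ‖z s‖ ≤ R := by
    intro s hs
    by_contra hcon
    obtain ⟨r, hr, hrR⟩ := hlevel s hs (not_le.1 hcon)
    exact hempty ⟨r, ⟨hr.1, hr.2.trans hs.2⟩, hrR⟩
  obtain ⟨D, z', hmax, hsub, heq⟩ := (hsol b ⟨hab, le_rfl⟩ hle).exists_isMaximalSolution
  exact ⟨D, z', hmax, hsub, by rw [← heq ⟨le_rfl, hab⟩, hza]⟩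

theorem ClassK.sup {φ ψ : ℝ → ℝ} (hφ : ClassK φ) (hψ : ClassK ψ) :
    ClassK fun r => max (φ r) (ψ r) :=
  ⟨ContinuousOn.sup hφ.1 hψ.1, fun _ hr _ hs hrs => max_lt_max (hφ.2.1 hr hs hrs) (hψ.2.1 hr hs hrs), by
    simp [hφ.2.2, hψ.2.2]⟩

theorem ClassK.intervalIntegrable_comp_norm {Y : Type*} [NormedAddCommGroup Y] [NormedSpace ℝ Y]
    [MeasurableSpace Y] [OpensMeasurableSpace Y] {φ : ℝ → ℝ} (hφ : ClassK φ) {u : ℝ → Y}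
    (hu : IsInput u) {a b : ℝ} (ha : 0 ≤ a) (hab : a ≤ b) :
    IntervalIntegrable (fun s => φ ‖u s‖) volume a b := by
  have hcont : Continuous fun r => φ (max r 0) :=
    hφ.1.comp_continuous (by fun_prop) fun r => le_max_right r 0
  have hmeas : Measurable fun s => φ ‖u s‖ := by
    have h : (fun s => φ ‖u s‖) = fun s => φ (max ‖u s‖ 0) := by
      funext s
      rw [max_eq_left (norm_nonneg _)]
    rw [h]
    exact hcont.measurable.comp hu.1.norm
  obtain ⟨C, hC⟩ := hu.2 b
  rw [intervalIntegrable_iff_integrableOn_Icc_of_le hab]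
  refine IntegrableOn.of_bound measure_Icc_lt_top hmeas.aestronglyMeasurable (φ C) ?_
  filter_upwards [ae_restrict_of_ae hC, ae_restrict_mem measurableSet_Icc] with s hs hs'
  rw [Real.norm_of_nonneg (hφ.nonneg (norm_nonneg _))]
  exact hφ.mono (norm_nonneg _) (hs ⟨ha.trans hs'.1, hs'.2⟩)

/-- On a ball, the effect of the input on the vector field is at most a small constant plus a
multiple of `γ`. -/
theorem AssumptionA.exists_input_effect_le {X Y Λ : Type*} [NormedAddCommGroup X]
    [NormedSpace ℝ X] [NormedAddCommGroup Y] [NormedSpace ℝ Y]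
    [MeasurableSpace X] [MeasurableSpace Y] {f : ℝ → X → Y → Λ → X} {γ : ℝ → ℝ}
    (hA : AssumptionA f γ) {R e : ℝ} (hR : 0 < R) (he : 0 < e) :
    ∃ κ, 0 < κ ∧ ∀ t, 0 ≤ t → ∀ (i : Λ) (ξ : X) (μ : Y), ‖ξ‖ ≤ R →
      ‖f t ξ μ i - f t ξ 0 i‖ ≤ e + κ * γ ‖μ‖ := by
  obtain ⟨hγ, ⟨N, hN0, hNm, hN⟩, hC2, -⟩ := hA
  obtain ⟨δ, hδ, hsmall⟩ := hC2 R hR e he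
  have hγδ := hγ.pos hδ
  have hNR := hN0 R hR.le
  refine ⟨N R * (2 / γ δ + 1), by positivity, fun t ht i ξ μ hξ => ?_⟩
  have hγμ := hγ.nonneg (norm_nonneg μ)
  rcases le_or_gt ‖μ‖ δ with hμ | hμ
  · have := hsmall t ht i ξ μ hξ hμ
    have : 0 ≤ N R * (2 / γ δ + 1) * γ ‖μ‖ := by positivity
    linarith
  · have hNξ : N ‖ξ‖ ≤ N R := hNm (norm_nonneg ξ) hR.le hξ
    have h1 : ‖f t ξ μ i‖ ≤ N R * (1 + γ ‖μ‖) := (hN t ht ξ μ i).trans (by gcongr)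
    have h2 : ‖f t ξ 0 i‖ ≤ N R := by
      have := hN t ht ξ 0 i
      rw [norm_zero, hγ.2.2, add_zero, mul_one] at this
      exact this.trans hNξ
    have h3 : 1 ≤ γ ‖μ‖ / γ δ := (one_le_div hγδ).2 (hγ.mono hδ.le hμ.le)
    calc ‖f t ξ μ i - f t ξ 0 i‖ ≤ N R * (1 + γ ‖μ‖) + N R := (norm_sub_le _ _).trans (by gcongr)
      _ = N R * (2 * 1 + γ ‖μ‖) := by ring
      _ ≤ N R * (2 * (γ ‖μ‖ / γ δ) + γ ‖μ‖) := by gcongr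
      _ = N R * (2 / γ δ + 1) * γ ‖μ‖ := by ring
      _ ≤ _ := by linarith

/-- Distance between a solution and the zero-input solution with the same initial value. -/
theorem IsSolution.norm_sub_zero_input_le {X Y Λ : Type*} [NormedAddCommGroup X]
    [NormedSpace ℝ X] [NormedAddCommGroup Y] [NormedSpace ℝ Y]
    [MeasurableSpace X] [MeasurableSpace Y] {f : ℝ → X → Y → Λ → X} {γ : ℝ → ℝ}
    {u : ℝ → Y} {σ : ℝ → Λ} {D D' : Set ℝ} {x z : ℝ → X} {a b R L e κ : ℝ}
    (hx : IsSolution f u σ D x) (hz : IsSolution f (fun _ => (0 : Y)) σ D' z)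
    (hD : Icc a b ⊆ D) (hD' : Icc a b ⊆ D') (hab : a ≤ b) (hxz : z a = x a)
    (hxR : ∀ t ∈ Icc a b, ‖x t‖ ≤ R) (hzR : ∀ t ∈ Icc a b, ‖z t‖ ≤ R) (hL : 0 ≤ L)
    (hLip : ∀ t, 0 ≤ t → ∀ (i : Λ), ∀ ξ ∈ Metric.closedBall (0 : X) R,
      ∀ ξ' ∈ Metric.closedBall (0 : X) R, ‖f t ξ 0 i - f t ξ' 0 i‖ ≤ L * ‖ξ - ξ'‖)
    (he : 0 ≤ e) (hκ : 0 ≤ κ) (hγ : ∀ r, 0 ≤ r → 0 ≤ γ r)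
    (heff : ∀ t, 0 ≤ t → ∀ (i : Λ) (ξ : X) (μ : Y), ‖ξ‖ ≤ R →
      ‖f t ξ μ i - f t ξ 0 i‖ ≤ e + κ * γ ‖μ‖)
    (hint : IntervalIntegrable (fun s => γ ‖u s‖) volume a b) :
    ‖x b - z b‖ ≤ (e * (b - a) + κ * ∫ s in a..b, γ ‖u s‖) * Real.exp (L * (b - a)) := by
  have hwc : ContinuousOn (fun t => ‖x t - z t‖) (Icc a b) :=
    ((hx.continuousOn.mono hD).sub (hz.continuousOn.mono hD')).norm
  have haab : a ∈ Icc a b := ⟨le_rfl, hab⟩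
  refine le_mul_exp_of_le_add_integral_s9 hL hwc (fun t ht => ?_) b ⟨hab, le_rfl⟩
  have hsub : uIcc a t ⊆ uIcc a b := by
    rw [uIcc_of_le ht.1, uIcc_of_le hab]
    exact Icc_subset_Icc_right ht.2
  have hγt : IntervalIntegrable (fun s => γ ‖u s‖) volume a t := hint.mono_set hsub
  have hwt : IntervalIntegrable (fun s => ‖x s - z s‖) volume a t :=
    (hwc.mono (by rw [uIcc_of_le ht.1]; exact Icc_subset_Icc_right ht.2)).intervalIntegrable
  have hdiff : x t - z t =
      ∫ s in a..t, (f s (x s) (u s) (σ s) - f s (z s) 0 (σ s)) := by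
    rw [intervalIntegral.integral_sub (hx.intervalIntegrable a (hD haab) t (hD ht))
      (hz.intervalIntegrable a (hD' haab) t (hD' ht)), hx.integral_eq a (hD haab) t (hD ht),
      hz.integral_eq a (hD' haab) t (hD' ht), hxz]
    abel
  have hbound : ‖x t - z t‖ ≤ ∫ s in a..t, ((e + κ * γ ‖u s‖) + L * ‖x s - z s‖) := by
    rw [hdiff]
    refine intervalIntegral.norm_integral_le_of_norm_le ht.1 (ae_of_all _ fun s hs => ?_)
      ((intervalIntegrable_const.add (hγt.const_mul κ)).add (hwt.const_mul L))
    have hs' : s ∈ Icc a b := ⟨hs.1.le, hs.2.trans ht.2⟩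
    have hs0 : 0 ≤ s := hx.subset_Ici (hD hs')
    have h1 := heff s hs0 (σ s) (x s) (u s) (hxR s hs')
    have h2 := hLip s hs0 (σ s) (x s) (by simpa using hxR s hs') (z s) (by simpa using hzR s hs')
    have h3 := norm_sub_le_norm_sub_add_norm_sub (f s (x s) (u s) (σ s)) (f s (x s) 0 (σ s))
      (f s (z s) 0 (σ s))
    linarith
  rw [intervalIntegral.integral_add (intervalIntegrable_const.add (hγt.const_mul κ))
    (hwt.const_mul L), intervalIntegral.integral_add intervalIntegrable_const (hγt.const_mul κ),
    intervalIntegral.integral_const, intervalIntegral.integral_const_mul,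
    intervalIntegral.integral_const_mul, smul_eq_mul] at hbound
  have hγmono : ∫ s in a..t, γ ‖u s‖ ≤ ∫ s in a..b, γ ‖u s‖ :=
    intervalIntegral.integral_mono_interval le_rfl ht.1 ht.2
      (ae_of_all _ fun s => hγ _ (norm_nonneg _)) hint
  have h4 : (t - a) * e ≤ e * (b - a) := by nlinarith [ht.2]
  have h5 := mul_le_mul_of_nonneg_left hγmono hκ
  linarith

/-- Trajectories starting near the origin with small input energy remain near the origin,
uniformly in the initial time and the switching signal. -/
theorem exists_uniform_stability_bound {X Y Λ : Type*} [NormedAddCommGroup X]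
    [NormedSpace ℝ X] [ProperSpace X] [NormedAddCommGroup Y] [NormedSpace ℝ Y]
    [MeasurableSpace X] [BorelSpace X] [MeasurableSpace Y] [OpensMeasurableSpace Y]
    {f : ℝ → X → Y → Λ → X} (hf : Regular f) {S : Set (ℝ → Λ)}
    (hS : ∀ σ ∈ S, IsSwitchingSignal σ) {γ : ℝ → ℝ} (hA : AssumptionA f γ) {α : ℝ → ℝ}
    (hα : ClassK α) (hGUAS : ZeroGUAS f S) (hUBEBS : UBEBS f S α) {ε : ℝ} (hε : 0 < ε) :
    ∃ δ, 0 < δ ∧ ∀ t₀, 0 ≤ t₀ → ∀ u : ℝ → Y, IsInput u → ∀ σ ∈ S, ∀ D x,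
      IsMaximalSolution f u σ D x → t₀ ∈ D → ∀ t ∈ D, t₀ ≤ t → ‖x t₀‖ ≤ δ →
        (∫ s in t₀..t, max (α ‖u s‖) (γ ‖u s‖)) ≤ δ → ‖x t‖ ≤ ε := by
  have hγ : ClassK γ := hA.1
  have hχ : ClassK fun r => max (α r) (γ r) := hα.sup hγ
  obtain ⟨β, ⟨hβK, hβL⟩, hβ⟩ := hGUAS
  obtain ⟨b₁, b₂, c, hb₁, hb₂, hc, hbound⟩ := hUBEBS
  have hβK0 : ClassK fun r => β r 0 := (hβK 0 le_rfl).1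
  obtain ⟨η₁, hη₁, hβη₁⟩ := hβK0.exists_pos_lt (half_pos hε)
  obtain ⟨η, hη, hηη₁, hηε, hη1⟩ : ∃ η, 0 < η ∧ η ≤ η₁ ∧ η ≤ ε ∧ η ≤ 1 :=
    ⟨min η₁ (min ε 1), by positivity, min_le_left _ _,
      (min_le_right _ _).trans (min_le_left _ _), (min_le_right _ _).trans (min_le_right _ _)⟩
  have hβη : β η 0 < ε / 2 := (hβK0.mono hη.le hηη₁).trans_lt hβη₁
  obtain ⟨T, hβT, hT⟩ : ∃ T, β η T < η / 2 ∧ 0 < T :=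
    (((hβL η hη.le).2.eventually (gt_mem_nhds (half_pos hη))).and (eventually_gt_atTop 0)).exists
  have hβle : ∀ r s, 0 ≤ r → r ≤ η → 0 ≤ s → β r s ≤ β η 0 := fun r s hr hrη hs =>
    ((hβK s hs).1.mono hr hrη).trans
      ((hβL η hη.le).1 (mem_Ici.2 le_rfl) (mem_Ici.2 hs) hs)
  let R : ℝ := b₁ 1 + b₂ 1 + c + ε
  have hR0 : 0 ≤ b₁ 1 + b₂ 1 + c := by
    have := hb₁.nonneg zero_le_one
    have := hb₂.nonneg zero_le_one
    positivity
  have hεR : ε ≤ R := le_add_of_nonneg_left hR0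
  have hR : 0 < R := hε.trans_le hεR
  obtain ⟨L, hL, hLip⟩ := hA.2.2.2 (Metric.closedBall 0 R) (isCompact_closedBall _ _)
  let e : ℝ := η / (4 * T * Real.exp (L * T))
  have he : 0 < e := by positivity
  obtain ⟨κ, hκ, heff⟩ := hA.exists_input_effect_le hR he
  let δ : ℝ := min η (η / (4 * κ * Real.exp (L * T)))
  have hδη : δ ≤ η := min_le_left _ _
  refine ⟨δ, by positivity, fun t₀ ht₀ u hu σ hσ D x hx htD t ht htt hx₀ hE => ?_⟩
  have hχi : ∀ a b, 0 ≤ a → a ≤ b →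
      IntervalIntegrable (fun s => max (α ‖u s‖) (γ ‖u s‖)) volume a b := fun a b ha hab =>
    hχ.intervalIntegrable_comp_norm hu ha hab
  have hsubE : ∀ a b, t₀ ≤ a → a ≤ b → b ≤ t →
      ∫ s in a..b, max (α ‖u s‖) (γ ‖u s‖) ≤ δ := fun a b ha hab hb =>
    (intervalIntegral.integral_mono_interval ha hab hb
      (ae_of_all _ fun s => hχ.nonneg (norm_nonneg _)) (hχi t₀ t ht₀ htt)).trans hE
  have hD : Icc t₀ t ⊆ D := hx.1.ordConnected.out htD ht
  have hxR : ∀ s ∈ Icc t₀ t, ‖x s‖ ≤ R := by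
    intro s hs
    have h1 := hbound t₀ ht₀ u hu σ hσ D x hx htD s (hD hs) hs.1
    have h2 : ∫ s in t₀..s, α ‖u s‖ ≤ 1 :=
      (intervalIntegral.integral_mono_on hs.1 (hα.intervalIntegrable_comp_norm hu ht₀ hs.1)
        (hχi t₀ s ht₀ hs.1) fun s _ => le_max_left _ _).trans
        ((hsubE t₀ s le_rfl hs.1 hs.2).trans (hδη.trans hη1))
    have h3 : 0 ≤ ∫ s in t₀..s, α ‖u s‖ :=
      intervalIntegral.integral_nonneg hs.1 fun s _ => hα.nonneg (norm_nonneg _)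
    have h4 := hb₁.mono (norm_nonneg _) (hx₀.trans (hδη.trans hη1))
    have h5 := hb₂.mono h3 h2
    dsimp only [R]
    linarith
  have hstep : ∀ a b, t₀ ≤ a → a ≤ b → b ≤ t → b - a ≤ T → ‖x a‖ ≤ η →
      ‖x b‖ ≤ β η (b - a) + η / 2 := by
    intro a b ha hab hb hbT hxa
    have ha0 : 0 ≤ a := ht₀.trans ha
    have hprior : ∀ D z, IsMaximalSolution f (fun _ => (0 : Y)) σ D z → a ∈ D → z a = x a →
        ∀ s ∈ D, a ≤ s → ‖z s‖ < R := by
      intro D' z hz haD' hza s hs has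
      have h1 := hβ a ha0 σ hσ D' z hz haD' s hs has
      have h2 := hβle ‖z a‖ (s - a) (norm_nonneg _) (by rwa [hza]) (by linarith)
      linarith
    obtain ⟨D', z, hz, hD', hza⟩ := exists_zero_input_solution hf hA (hS σ hσ) ha0 hab
      (hxa.trans (hηε.trans hεR)) hprior
    have haD' : a ∈ D' := hD' ⟨le_rfl, hab⟩
    have hbD' : b ∈ D' := hD' ⟨hab, le_rfl⟩
    have hcomp := hx.1.norm_sub_zero_input_le hz.1
      (fun s hs => hD ⟨ha.trans hs.1, hs.2.trans hb⟩) hD' hab hza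
      (fun s hs => hxR s ⟨ha.trans hs.1, hs.2.trans hb⟩)
      (fun s hs => (hprior D' z hz haD' hza s (hD' hs) hs.1).le) hL hLip he.le hκ.le
      (fun r hr => hγ.nonneg hr) heff (hγ.intervalIntegrable_comp_norm hu ha0 hab)
    have hγE : ∫ s in a..b, γ ‖u s‖ ≤ η / (4 * κ * Real.exp (L * T)) :=
      (intervalIntegral.integral_mono_on hab (hγ.intervalIntegrable_comp_norm hu ha0 hab)
        (hχi a b ha0 hab) fun s _ => le_max_right _ _).trans
        ((hsubE a b ha hab hb).trans (min_le_right _ _))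
    have hclose : ‖x b - z b‖ ≤ η / 2 :=
      calc ‖x b - z b‖ ≤ _ := hcomp
        _ ≤ (e * T + κ * (η / (4 * κ * Real.exp (L * T)))) * Real.exp (L * T) := by gcongr
        _ = η / 2 := by
          dsimp only [e]
          field_simp
          ring
    have hzb : ‖z b‖ ≤ β η (b - a) :=
      (hβ a ha0 σ hσ D' z hz haD' b hbD' hab).trans
        ((hβK (b - a) (by linarith)).1.mono (norm_nonneg _) (by rwa [hza]))
    have := norm_le_norm_add_norm_sub' (x b) (z b)
    linarith
  have hgrid : ∀ k : ℕ, t₀ + k * T ≤ t → ‖x (t₀ + k * T)‖ ≤ η := by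
    intro k
    induction k with
    | zero => simpa using fun _ => hx₀.trans hδη
    | succ k ih =>
      intro hk
      push_cast at hk ⊢
      have hkT : 0 ≤ k * T := by positivity
      have h := hstep (t₀ + k * T) (t₀ + (k + 1) * T) (by linarith) (by linarith) hk (by linarith)
        (ih (by linarith))
      rw [show t₀ + (k + 1) * T - (t₀ + k * T) = T by ring] at h
      linarith
  have hk := Nat.floor_le (div_nonneg (sub_nonneg.2 htt) hT.le)
  have hk' := Nat.lt_floor_add_one ((t - t₀) / T)
  rw [le_div_iff₀ hT] at hk
  rw [div_lt_iff₀ hT] at hk'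
  set k := ⌊(t - t₀) / T⌋₊
  have hkT : 0 ≤ k * T := by positivity
  have h := hstep (t₀ + k * T) t (by linarith) (by linarith) le_rfl (by linarith)
    (hgrid k (by linarith))
  have h' := hβle η (t - (t₀ + k * T)) hη.le le_rfl (by linarith)
  linarith

/-- Lemma `0UBEBS`: under Assumption A with `γ` as in (C1), if the system
is 0-GUAS w.r.t. `S` and UBEBS w.r.t. `S` with UBEBS gain `α`, then the UBEBS estimate holds
with additive constant `c = 0` and gain `χ = max {α, γ}`. -/
theorem stmt9 {n m : ℕ} {Γ : Type*} [Nonempty Γ]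
    (f : ℝ → EuclideanSpace ℝ (Fin n) → EuclideanSpace ℝ (Fin m) → Γ → EuclideanSpace ℝ (Fin n))
    (hreg : Regular f)
    (S : Set (ℝ → Γ)) (hS : ∀ σ ∈ S, IsSwitchingSignal σ)
    (γ : ℝ → ℝ) (hA : AssumptionA f γ)
    (α : ℝ → ℝ) (hα : ClassK α)
    (hGUAS : ZeroGUAS f S) (hUBEBS : UBEBS f S α) :
    ∃ α₁ α₂ : ℝ → ℝ, ClassK α₁ ∧ ClassK α₂ ∧
      ∀ t₀, 0 ≤ t₀ → ∀ u, IsInput u → ∀ σ ∈ S, ∀ D x,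
        IsMaximalSolution f u σ D x → t₀ ∈ D → ∀ t ∈ D, t₀ ≤ t →
          ‖x t‖ ≤ α₁ ‖x t₀‖ + α₂ (∫ s in t₀..t, max (α ‖u s‖) (γ ‖u s‖)) := by
  obtain ⟨b₁, b₂, c, hb₁, hb₂, hc, hbound⟩ := hUBEBS
  have hχ : ClassK fun r => max (α r) (γ r) := hα.sup hA.1
  let A : Set (ℝ × ℝ) := {p | ∃ t₀, 0 ≤ t₀ ∧ ∃ u, IsInput u ∧ ∃ σ ∈ S, ∃ D x,
    IsMaximalSolution f u σ D x ∧ t₀ ∈ D ∧ ∃ t ∈ D, t₀ ≤ t ∧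
      p = (max ‖x t₀‖ (∫ s in t₀..t, max (α ‖u s‖) (γ ‖u s‖)), ‖x t‖)}
  obtain ⟨ω, hω, hωA⟩ := exists_classK_dominating A
    (by
      rintro p ⟨t₀, ht₀, u, hu, σ, hσ, D, x, hx, htD, t, ht, htt, rfl⟩
      exact (norm_nonneg _).trans (le_max_left _ _))
    (by
      intro ε hε
      obtain ⟨δ, hδ, h⟩ := exists_uniform_stability_bound hreg hS hA hα hGUAS
        ⟨b₁, b₂, c, hb₁, hb₂, hc, hbound⟩ hε
      refine ⟨δ, hδ, ?_⟩
      rintro p ⟨t₀, ht₀, u, hu, σ, hσ, D, x, hx, htD, t, ht, htt, rfl⟩ hp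
      exact h t₀ ht₀ u hu σ hσ D x hx htD t ht htt ((le_max_left _ _).trans hp)
        ((le_max_right _ _).trans hp))
    b₁ b₂ c hb₁ hb₂ hc
    (by
      rintro p ⟨t₀, ht₀, u, hu, σ, hσ, D, x, hx, htD, t, ht, htt, rfl⟩
      refine (hbound t₀ ht₀ u hu σ hσ D x hx htD t ht htt).trans ?_
      have h1 : ∫ s in t₀..t, α ‖u s‖ ≤ ∫ s in t₀..t, max (α ‖u s‖) (γ ‖u s‖) :=
        intervalIntegral.integral_mono_on htt (hα.intervalIntegrable_comp_norm hu ht₀ htt)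
          (hχ.intervalIntegrable_comp_norm hu ht₀ htt) fun s _ => le_max_left _ _
      have h2 : 0 ≤ ∫ s in t₀..t, α ‖u s‖ :=
        intervalIntegral.integral_nonneg htt fun s _ => hα.nonneg (norm_nonneg _)
      have h3 := hb₁.mono (norm_nonneg (x t₀))
        (le_max_left _ (∫ s in t₀..t, max (α ‖u s‖) (γ ‖u s‖)))
      have h4 := hb₂.mono h2 (h1.trans (le_max_right ‖x t₀‖ _))
      dsimp only
      linarith)
  refine ⟨ω, ω, hω, hω, fun t₀ ht₀ u hu σ hσ D x hx htD t ht htt => ?_⟩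
  have hE : 0 ≤ ∫ s in t₀..t, max (α ‖u s‖) (γ ‖u s‖) :=
    intervalIntegral.integral_nonneg htt fun s _ => hχ.nonneg (norm_nonneg _)
  have hxn := norm_nonneg (x t₀)
  refine (hωA _ ⟨t₀, ht₀, u, hu, σ, hσ, D, x, hx, htD, t, ht, htt, rfl⟩).trans ?_
  dsimp only
  rcases max_choice ‖x t₀‖ (∫ s in t₀..t, max (α ‖u s‖) (γ ‖u s‖)) with h | h <;> rw [h]
  · exact le_add_of_nonneg_right (hω.nonneg hE)
  · exact le_add_of_nonneg_left (hω.nonneg hxn)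
end
end
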